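/- arXiv:2005.11751 — 5 statements merged into one kernel-verified Lean document; each statement's English description precedes it below -/
import Mathlib

section
/- The singular pure braid group SP_3 = ker π is generated, as a subgroup of SG_3, by the six elements a12 = σ1², a13 = σ2σ1²σ2⁻¹, a23 = σ2², b12 = σ1τ1, b13 = σ2σ1τ1σ2⁻¹, b23 = σ2τ2; that is, ker π equals the subgroup of SG_3 generated by these six elements. -/
/-- Defining relations of the singular braid group `SG₃`, as elements of the free
group on four generators `0 ↦ σ₁`, `1 ↦ σ₂`, `2 ↦ τ₁`, `3 ↦ τ₂`. -/
def sg3Rels : Set (FreeGroup (Fin 4)) :=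
  {FreeGroup.of 0 * FreeGroup.of 2 * (FreeGroup.of 2 * FreeGroup.of 0)⁻¹,
   FreeGroup.of 1 * FreeGroup.of 3 * (FreeGroup.of 3 * FreeGroup.of 1)⁻¹,
   FreeGroup.of 0 * FreeGroup.of 1 * FreeGroup.of 0 *
     (FreeGroup.of 1 * FreeGroup.of 0 * FreeGroup.of 1)⁻¹,
   FreeGroup.of 0 * FreeGroup.of 1 * FreeGroup.of 2 *
     (FreeGroup.of 3 * FreeGroup.of 0 * FreeGroup.of 1)⁻¹,
   FreeGroup.of 1 * FreeGroup.of 0 * FreeGroup.of 3 *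
     (FreeGroup.of 2 * FreeGroup.of 1 * FreeGroup.of 0)⁻¹}

/-- The singular braid group on 3 strands. -/
abbrev SG3 : Type := PresentedGroup sg3Rels

def σ1 : SG3 := PresentedGroup.of 0
def σ2 : SG3 := PresentedGroup.of 1
def τ1 : SG3 := PresentedGroup.of 2
def τ2 : SG3 := PresentedGroup.of 3

def a12 : SG3 := σ1 ^ 2
def a13 : SG3 := σ2 * σ1 ^ 2 * σ2⁻¹
def a23 : SG3 := σ2 ^ 2
def b12 : SG3 := σ1 * τ1
def b13 : SG3 := σ2 * σ1 * τ1 * σ2⁻¹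
def b23 : SG3 := σ2 * τ2

theorem sg3_rel {x y : FreeGroup (Fin 4)} (h : x * y⁻¹ ∈ sg3Rels) :
    PresentedGroup.mk sg3Rels x = PresentedGroup.mk sg3Rels y := by
  have h1 : PresentedGroup.mk sg3Rels (x * y⁻¹) = 1 := PresentedGroup.one_of_mem h
  rw [map_mul, map_inv] at h1
  exact mul_inv_eq_one.mp h1

theorem sg3_r1 : σ1 * τ1 = τ1 * σ1 :=
  sg3_rel (x := FreeGroup.of 0 * FreeGroup.of 2) (y := FreeGroup.of 2 * FreeGroup.of 0)
    (by simp [sg3Rels])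

theorem sg3_r2 : σ2 * τ2 = τ2 * σ2 :=
  sg3_rel (x := FreeGroup.of 1 * FreeGroup.of 3) (y := FreeGroup.of 3 * FreeGroup.of 1)
    (by simp [sg3Rels])

theorem sg3_r3 : σ1 * σ2 * σ1 = σ2 * σ1 * σ2 :=
  sg3_rel (x := FreeGroup.of 0 * FreeGroup.of 1 * FreeGroup.of 0)
    (y := FreeGroup.of 1 * FreeGroup.of 0 * FreeGroup.of 1) (by simp [sg3Rels])

theorem sg3_r4 : σ1 * σ2 * τ1 = τ2 * σ1 * σ2 :=
  sg3_rel (x := FreeGroup.of 0 * FreeGroup.of 1 * FreeGroup.of 2)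
    (y := FreeGroup.of 3 * FreeGroup.of 0 * FreeGroup.of 1) (by simp [sg3Rels])

theorem sg3_r5 : σ2 * σ1 * τ2 = τ1 * σ2 * σ1 :=
  sg3_rel (x := FreeGroup.of 1 * FreeGroup.of 0 * FreeGroup.of 3)
    (y := FreeGroup.of 2 * FreeGroup.of 1 * FreeGroup.of 0) (by simp [sg3Rels])

/-- The subgroup generated by the six elements. -/
def sg3H : Subgroup SG3 := Subgroup.closure {a12, a13, a23, b12, b13, b23}

theorem a12_mem : a12 ∈ sg3H := Subgroup.subset_closure (by simp)
theorem a13_mem : a13 ∈ sg3H := Subgroup.subset_closure (by simp)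
theorem a23_mem : a23 ∈ sg3H := Subgroup.subset_closure (by simp)
theorem b12_mem : b12 ∈ sg3H := Subgroup.subset_closure (by simp)
theorem b13_mem : b13 ∈ sg3H := Subgroup.subset_closure (by simp)
theorem b23_mem : b23 ∈ sg3H := Subgroup.subset_closure (by simp)

theorem sg3_conj_of_gens (g : SG3)
    (h : ∀ x ∈ ({a12, a13, a23, b12, b13, b23} : Set SG3), g * x * g⁻¹ ∈ sg3H) :
    ∀ x ∈ sg3H, g * x * g⁻¹ ∈ sg3H := by
  have h1 : sg3H ≤ sg3H.comap (MulAut.conj g).toMonoidHom := by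
    conv_lhs => rw [sg3H]
    rw [Subgroup.closure_le]
    intro x hx
    simpa using h x hx
  intro x hx
  simpa using h1 hx

theorem conj_σ2 : ∀ x ∈ sg3H, σ2 * x * σ2⁻¹ ∈ sg3H := by
  apply sg3_conj_of_gens
  rintro x (rfl | rfl | rfl | rfl | rfl | rfl)
  · exact a13_mem
  · have : σ2 * a13 * σ2⁻¹ = a23 * a12 * a23⁻¹ := by
      simp [a13, a23, a12, pow_two, mul_assoc]
    rw [this]
    exact mul_mem (mul_mem a23_mem a12_mem) (inv_mem a23_mem)
  · have : σ2 * a23 * σ2⁻¹ = a23 := by simp [a23, pow_two, mul_assoc]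
    rw [this]; exact a23_mem
  · have : σ2 * b12 * σ2⁻¹ = b13 := by simp [b12, b13, pow_two, mul_assoc]
    rw [this]; exact b13_mem
  · have : σ2 * b13 * σ2⁻¹ = a23 * b12 * a23⁻¹ := by
      simp [b13, a23, b12, pow_two, mul_assoc]
    rw [this]
    exact mul_mem (mul_mem a23_mem b12_mem) (inv_mem a23_mem)
  · have : σ2 * b23 * σ2⁻¹ = b23 := by
      simp only [b23]; rw [mul_inv_eq_iff_eq_mul, mul_assoc σ2 τ2, ← sg3_r2]
    rw [this]; exact b23_mem

theorem conj_σ1 : ∀ x ∈ sg3H, σ1 * x * σ1⁻¹ ∈ sg3H := by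
  have e1 : σ1 * σ2 * σ1⁻¹ = σ2⁻¹ * σ1 * σ2 := by
    rw [mul_inv_eq_iff_eq_mul, mul_assoc, mul_assoc, eq_inv_mul_iff_mul_eq, ← mul_assoc,
      ← mul_assoc, sg3_r3]
  have e2 : σ1 * τ2 * σ1⁻¹ = σ2⁻¹ * τ1 * σ2 := by
    rw [mul_inv_eq_iff_eq_mul, mul_assoc, mul_assoc, eq_inv_mul_iff_mul_eq, ← mul_assoc,
      ← mul_assoc, sg3_r5]
  have e3 : (σ1 * σ2) * σ1 * (σ1 * σ2)⁻¹ = σ2 := by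
    rw [mul_inv_eq_iff_eq_mul, sg3_r3, mul_assoc]
  have e4 : (σ1 * σ2) * τ1 * (σ1 * σ2)⁻¹ = τ2 := by
    rw [mul_inv_eq_iff_eq_mul, sg3_r4, mul_assoc]
  apply sg3_conj_of_gens
  rintro x (rfl | rfl | rfl | rfl | rfl | rfl)
  · have : σ1 * a12 * σ1⁻¹ = a12 := by simp [a12, pow_two, mul_assoc]
    rw [this]; exact a12_mem
  · have : σ1 * a13 * σ1⁻¹ =
        ((σ1 * σ2) * σ1 * (σ1 * σ2)⁻¹) * ((σ1 * σ2) * σ1 * (σ1 * σ2)⁻¹) := by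
      simp [a13, pow_two, mul_assoc]
    rw [this, e3, ← pow_two]; exact a23_mem
  · have : σ1 * a23 * σ1⁻¹ = (σ1 * σ2 * σ1⁻¹) * (σ1 * σ2 * σ1⁻¹) := by
      simp [a23, pow_two, mul_assoc]
    rw [this, e1]
    have : σ2⁻¹ * σ1 * σ2 * (σ2⁻¹ * σ1 * σ2) = a23⁻¹ * a13 * a23 := by
      simp [a23, a13, pow_two, mul_assoc]
    rw [this]
    exact mul_mem (mul_mem (inv_mem a23_mem) a13_mem) a23_mem
  · have : σ1 * b12 * σ1⁻¹ = b12 := by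
      simp only [b12]; rw [mul_inv_eq_iff_eq_mul, mul_assoc σ1 τ1, ← sg3_r1]
    rw [this]; exact b12_mem
  · have : σ1 * b13 * σ1⁻¹ =
        ((σ1 * σ2) * σ1 * (σ1 * σ2)⁻¹) * ((σ1 * σ2) * τ1 * (σ1 * σ2)⁻¹) := by
      simp [b13, pow_two, mul_assoc]
    rw [this, e3, e4]; exact b23_mem
  · have : σ1 * b23 * σ1⁻¹ = (σ1 * σ2 * σ1⁻¹) * (σ1 * τ2 * σ1⁻¹) := by
      simp [b23, pow_two, mul_assoc]
    rw [this, e1, e2]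
    have : σ2⁻¹ * σ1 * σ2 * (σ2⁻¹ * τ1 * σ2) = a23⁻¹ * b13 * a23 := by
      simp [a23, b13, pow_two, mul_assoc]
    rw [this]
    exact mul_mem (mul_mem (inv_mem a23_mem) b13_mem) a23_mem

/-- Every element is a product of an element of the subgroup and a coset representative. -/
def sg3Good (g : SG3) : Prop :=
  ∃ r ∈ ({1, σ1, σ2, σ1 * σ2, σ2 * σ1, σ1 * σ2 * σ1} : Set SG3), g * r⁻¹ ∈ sg3H

theorem good_of {g r : SG3} (h : SG3) (hh : h ∈ sg3H) (e : g = h * r) (hr : sg3Good r) :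
    sg3Good g := by
  obtain ⟨q, hq, hm⟩ := hr
  refine ⟨q, hq, ?_⟩
  rw [e, mul_assoc]
  exact mul_mem hh hm

theorem good_rep {r : SG3}
    (h : r ∈ ({1, σ1, σ2, σ1 * σ2, σ2 * σ1, σ1 * σ2 * σ1} : Set SG3)) : sg3Good r :=
  ⟨r, h, by simp [one_mem]⟩

theorem good_σ1 {g : SG3} (hg : sg3Good g) : sg3Good (σ1 * g) := by
  obtain ⟨r, hr, hm⟩ := hg
  refine good_of (r := σ1 * r) _ (conj_σ1 _ hm) (by group) ?_
  rcases hr with rfl | rfl | rfl | rfl | rfl | rfl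
  · exact good_rep (by simp)
  · exact good_of (r := 1) _ a12_mem (by simp [a12, pow_two, mul_assoc]) (good_rep (by simp))
  · exact good_rep (by simp)
  · exact good_of (r := σ2) _ a12_mem (by simp [a12, pow_two, mul_assoc]) (good_rep (by simp))
  · exact good_rep (by simp [mul_assoc])
  · exact good_of (r := σ2 * σ1) _ a12_mem (by simp [a12, pow_two, mul_assoc]) (good_rep (by simp))

theorem good_σ2 {g : SG3} (hg : sg3Good g) : sg3Good (σ2 * g) := by
  obtain ⟨r, hr, hm⟩ := hg
  refine good_of (r := σ2 * r) _ (conj_σ2 _ hm) (by group) ?_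
  rcases hr with rfl | rfl | rfl | rfl | rfl | rfl
  · exact good_rep (by simp)
  · exact good_rep (by simp)
  · exact good_of (r := 1) _ a23_mem (by simp [a23, pow_two, mul_assoc]) (good_rep (by simp))
  · rw [← mul_assoc, ← sg3_r3]; exact good_rep (by simp)
  · exact good_of (r := σ1) _ a23_mem (by simp [a23, pow_two, mul_assoc]) (good_rep (by simp))
  · rw [sg3_r3]
    exact good_of (r := σ1 * σ2) _ a23_mem (by simp [a23, pow_two, mul_assoc]) (good_rep (by simp))

theorem good_σ1_inv {g : SG3} (hg : sg3Good g) : sg3Good (σ1⁻¹ * g) :=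
  good_of (r := σ1 * g) _ (inv_mem a12_mem) (by simp [a12, pow_two, mul_assoc]) (good_σ1 hg)

theorem good_σ2_inv {g : SG3} (hg : sg3Good g) : sg3Good (σ2⁻¹ * g) :=
  good_of (r := σ2 * g) _ (inv_mem a23_mem) (by simp [a23, pow_two, mul_assoc]) (good_σ2 hg)

theorem good_τ1 {g : SG3} (hg : sg3Good g) : sg3Good (τ1 * g) :=
  good_of (r := σ1⁻¹ * g) _ b12_mem (by simp only [b12]; rw [sg3_r1]; group) (good_σ1_inv hg)

theorem good_τ2 {g : SG3} (hg : sg3Good g) : sg3Good (τ2 * g) :=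
  good_of (r := σ2⁻¹ * g) _ b23_mem (by simp only [b23]; rw [sg3_r2]; group) (good_σ2_inv hg)

theorem good_τ1_inv {g : SG3} (hg : sg3Good g) : sg3Good (τ1⁻¹ * g) :=
  good_of (r := σ1 * g) _ (inv_mem b12_mem) (by simp [b12, pow_two, mul_assoc]) (good_σ1 hg)

theorem good_τ2_inv {g : SG3} (hg : sg3Good g) : sg3Good (τ2⁻¹ * g) :=
  good_of (r := σ2 * g) _ (inv_mem b23_mem) (by simp [b23, pow_two, mul_assoc]) (good_σ2 hg)

theorem all_good (g : SG3) : sg3Good g := by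
  have hg : g ∈ Subgroup.closure (Set.range (PresentedGroup.of (rels := sg3Rels))) := by
    rw [PresentedGroup.closure_range_of]; trivial
  induction hg using Subgroup.closure_induction_left with
  | one => exact good_rep (by simp)
  | mul_left x hx y _ ih =>
    obtain ⟨i, rfl⟩ := hx
    fin_cases i
    exacts [good_σ1 ih, good_σ2 ih, good_τ1 ih, good_τ2 ih]
  | inv_mul_cancel x hx y _ ih =>
    obtain ⟨i, rfl⟩ := hx
    fin_cases i
    exacts [good_σ1_inv ih, good_σ2_inv ih, good_τ1_inv ih, good_τ2_inv ih]

/-- The singular pure braid group `SP₃ = ker π` is generated by the six elements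
`a₁₂, a₁₃, a₂₃, b₁₂, b₁₃, b₂₃`. -/
theorem stmt2 (π : SG3 →* Equiv.Perm (Fin 3))
    (hσ1 : π σ1 = Equiv.swap 0 1) (hτ1 : π τ1 = Equiv.swap 0 1)
    (hσ2 : π σ2 = Equiv.swap 1 2) (hτ2 : π τ2 = Equiv.swap 1 2) :
    MonoidHom.ker π =
      Subgroup.closure {a12, a13, a23, b12, b13, b23} := by
  have hle : sg3H ≤ MonoidHom.ker π := by
    rw [sg3H, Subgroup.closure_le]
    rintro x (rfl | rfl | rfl | rfl | rfl | rfl) <;>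
      simp [MonoidHom.mem_ker, a12, a13, a23, b12, b13, b23, hσ1, hσ2, hτ1, hτ2, pow_two, mul_assoc]
  refine le_antisymm ?_ hle
  intro g hg
  obtain ⟨r, hr, hm⟩ := all_good g
  have h1 : π r = 1 := by
    have h2 := hle hm
    rw [MonoidHom.mem_ker] at h2 hg
    rw [map_mul, map_inv, hg] at h2
    simpa using h2
  rcases hr with rfl | rfl | rfl | rfl | rfl | rfl
  · have h3 : g ∈ sg3H := by simpa using hm
    exact h3
  all_goals
    exfalso
    simp only [map_mul, hσ1, hσ2] at h1
    revert h1
    decide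
end

section
/- Let G be the group with presentation on six generators A12, A13, A23, B12, B13, B23 subject to the relations A12·A13·A12⁻¹ = A23⁻¹·A13·A23, A12·A23·A12⁻¹ = A23⁻¹·A13⁻¹·A23·A13·A23, A12·B12 = B12·A12, A13·B13 = B13·A13, A23·B23 = B23·A23, B12·(A13·A23)·B12⁻¹ = A13·A23, A12·B13·A12⁻¹ = A23⁻¹·B13·A23, A12·B23·A12⁻¹ = A23⁻¹·A13⁻¹·B23·A13·A23. Then there is a group isomorphism from G onto the subgroup SP_3 = ker π of SG_3 sending A12 ↦ σ1², A13 ↦ σ2σ1²σ2⁻¹, A23 ↦ σ2², B12 ↦ σ1τ1, B13 ↦ σ2σ1τ1σ2⁻¹, B23 ↦ σ2τ2. -/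
/-- Defining relations of the singular pure braid group `SP₃` on the generators
`0 ↦ A₁₂`, `1 ↦ A₁₃`, `2 ↦ A₂₃`, `3 ↦ B₁₂`, `4 ↦ B₁₃`, `5 ↦ B₂₃`. -/
def sp3Rels : Set (FreeGroup (Fin 6)) :=
  {FreeGroup.of 0 * FreeGroup.of 1 * (FreeGroup.of 0)⁻¹ *
     ((FreeGroup.of 2)⁻¹ * FreeGroup.of 1 * FreeGroup.of 2)⁻¹,
   FreeGroup.of 0 * FreeGroup.of 2 * (FreeGroup.of 0)⁻¹ *
     ((FreeGroup.of 2)⁻¹ * (FreeGroup.of 1)⁻¹ * FreeGroup.of 2 * FreeGroup.of 1 *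
       FreeGroup.of 2)⁻¹,
   FreeGroup.of 0 * FreeGroup.of 3 * (FreeGroup.of 3 * FreeGroup.of 0)⁻¹,
   FreeGroup.of 1 * FreeGroup.of 4 * (FreeGroup.of 4 * FreeGroup.of 1)⁻¹,
   FreeGroup.of 2 * FreeGroup.of 5 * (FreeGroup.of 5 * FreeGroup.of 2)⁻¹,
   FreeGroup.of 3 * (FreeGroup.of 1 * FreeGroup.of 2) * (FreeGroup.of 3)⁻¹ *
     (FreeGroup.of 1 * FreeGroup.of 2)⁻¹,
   FreeGroup.of 0 * FreeGroup.of 4 * (FreeGroup.of 0)⁻¹ *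
     ((FreeGroup.of 2)⁻¹ * FreeGroup.of 4 * FreeGroup.of 2)⁻¹,
   FreeGroup.of 0 * FreeGroup.of 5 * (FreeGroup.of 0)⁻¹ *
     ((FreeGroup.of 2)⁻¹ * (FreeGroup.of 1)⁻¹ * FreeGroup.of 5 * FreeGroup.of 1 *
       FreeGroup.of 2)⁻¹}

/-! ### Relations in `P` -/

namespace SPthree

abbrev P : Type := PresentedGroup sp3Rels

def A12 : P := PresentedGroup.of 0
def A13 : P := PresentedGroup.of 1
def A23 : P := PresentedGroup.of 2
def B12 : P := PresentedGroup.of 3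
def B13 : P := PresentedGroup.of 4
def B23 : P := PresentedGroup.of 5

lemma pr1 : A12 * A13 * A12⁻¹ = A23⁻¹ * A13 * A23 :=
  mul_inv_eq_one.1 (PresentedGroup.one_of_mem (rels := sp3Rels) (by simp [sp3Rels]))
lemma pr2 : A12 * A23 * A12⁻¹ = A23⁻¹ * A13⁻¹ * A23 * A13 * A23 :=
  mul_inv_eq_one.1 (PresentedGroup.one_of_mem (rels := sp3Rels) (by simp [sp3Rels]))
lemma pr3 : A12 * B12 = B12 * A12 :=
  mul_inv_eq_one.1 (PresentedGroup.one_of_mem (rels := sp3Rels) (by simp [sp3Rels]))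
lemma pr4 : A13 * B13 = B13 * A13 :=
  mul_inv_eq_one.1 (PresentedGroup.one_of_mem (rels := sp3Rels) (by simp [sp3Rels]))
lemma pr5 : A23 * B23 = B23 * A23 :=
  mul_inv_eq_one.1 (PresentedGroup.one_of_mem (rels := sp3Rels) (by simp [sp3Rels]))
lemma pr6 : B12 * (A13 * A23) * B12⁻¹ = A13 * A23 :=
  mul_inv_eq_one.1 (PresentedGroup.one_of_mem (rels := sp3Rels) (by simp [sp3Rels]))
lemma pr7 : A12 * B13 * A12⁻¹ = A23⁻¹ * B13 * A23 :=
  mul_inv_eq_one.1 (PresentedGroup.one_of_mem (rels := sp3Rels) (by simp [sp3Rels]))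
lemma pr8 : A12 * B23 * A12⁻¹ = A23⁻¹ * A13⁻¹ * B23 * A13 * A23 :=
  mul_inv_eq_one.1 (PresentedGroup.one_of_mem (rels := sp3Rels) (by simp [sp3Rels]))

lemma sr1 : σ1 * τ1 = τ1 * σ1 :=
  mul_inv_eq_one.1 (PresentedGroup.one_of_mem (rels := sg3Rels) (by simp [sg3Rels]))
lemma sr2 : σ2 * τ2 = τ2 * σ2 :=
  mul_inv_eq_one.1 (PresentedGroup.one_of_mem (rels := sg3Rels) (by simp [sg3Rels]))
lemma sr3 : σ1 * σ2 * σ1 = σ2 * σ1 * σ2 :=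
  mul_inv_eq_one.1 (PresentedGroup.one_of_mem (rels := sg3Rels) (by simp [sg3Rels]))
lemma sr4 : σ1 * σ2 * τ1 = τ2 * σ1 * σ2 :=
  mul_inv_eq_one.1 (PresentedGroup.one_of_mem (rels := sg3Rels) (by simp [sg3Rels]))
lemma sr5 : σ2 * σ1 * τ2 = τ1 * σ2 * σ1 :=
  mul_inv_eq_one.1 (PresentedGroup.one_of_mem (rels := sg3Rels) (by simp [sg3Rels]))

/-- A monomial permutation of `Fin 6 × P`. -/
def mono (f : Fin 6 → Fin 6) (hf : ∀ w, f (f w) = w) (c : Fin 6 → P) :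
    Equiv.Perm (Fin 6 × P) where
  toFun x := (f x.1, c x.1 * x.2)
  invFun x := (f x.1, (c (f x.1))⁻¹ * x.2)
  left_inv x := by simp [hf]
  right_inv x := by simp [hf]

def f1 : Fin 6 → Fin 6 := ![1, 0, 3, 2, 5, 4]
def f2 : Fin 6 → Fin 6 := ![2, 4, 0, 5, 1, 3]

def S1 : Equiv.Perm (Fin 6 × P) :=
  mono f1 (by decide) ![1, A12, 1, A23⁻¹ * A13 * A23, 1, A23]
def S2 : Equiv.Perm (Fin 6 × P) :=
  mono f2 (by decide) ![1, 1, A23, 1, A13, A12]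
def T1 : Equiv.Perm (Fin 6 × P) :=
  mono f1 (by decide)
    ![A12⁻¹ * B12, B12, A23⁻¹ * A13⁻¹ * B13 * A23, A23⁻¹ * B13 * A23, A23⁻¹ * B23, B23]
def T2 : Equiv.Perm (Fin 6 × P) :=
  mono f2 (by decide)
    ![A23⁻¹ * B23, A13⁻¹ * B13, B23, A12⁻¹ * B12, B13, B12]

/-- Cancel a common right factor after reassociation. -/
lemma ext_right {G : Type*} [Group G] {a b : G} (h : a = b) (p : G) : a * p = b * p := by rw [h]

lemma k1 : Commute (A23 * A12) A13 := by
  have h := pr1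
  rw [mul_inv_eq_iff_eq_mul] at h
  rw [Commute, SemiconjBy, mul_assoc, h]; group
lemma k2 : Commute (A23 * A12) B13 := by
  have h := pr7
  rw [mul_inv_eq_iff_eq_mul] at h
  rw [Commute, SemiconjBy, mul_assoc, h]; group
lemma k3 : Commute (A13 * A23) A12 := by
  have h1 := pr1
  have h2 := pr2
  have : A12 * (A13 * A23) * A12⁻¹ = A13 * A23 := by
    calc _ = (A12 * A13 * A12⁻¹) * (A12 * A23 * A12⁻¹) := by group
      _ = _ := by rw [h1, h2]; group
  rw [mul_inv_eq_iff_eq_mul] at this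
  exact this.symm
lemma k4 : Commute (A13 * A23) B12 := by
  have h := pr6
  rw [mul_inv_eq_iff_eq_mul] at h
  exact h.symm
lemma k5 : Commute (A12 * A13) B23 := by
  have h := pr8
  rw [mul_inv_eq_iff_eq_mul] at h
  have hz : Commute (A13 * A23 * A12) B23 := by
    rw [Commute, SemiconjBy, mul_assoc _ A12, h]; group
  have e : A12 * A13 = A13 * A23 * A12 * A23⁻¹ := by
    rw [k3.eq]; group
  rw [e]
  exact hz.mul_left (Commute.inv_left pr5)
lemma k6 : Commute A12 B12 := pr3
lemma k7 : Commute A13 B13 := pr4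
lemma k8 : Commute A23 B23 := pr5

lemma q1 : S1 * T1 = T1 * S1 := by
  refine Equiv.ext fun ⟨w, p⟩ => ?_
  fin_cases w <;> simp [S1, T1, mono, f1, mul_assoc]
  · rw [← mul_assoc B12, ← k6.eq]; group
  · rw [← mul_assoc B13 A13, ← k7.eq]; group
  · rw [← mul_assoc B23, ← k8.eq]; group
lemma q2 : S2 * T2 = T2 * S2 := by
  refine Equiv.ext fun ⟨w, p⟩ => ?_
  fin_cases w <;> simp [S2, T2, mono, f2, mul_assoc]
  · rw [← mul_assoc B23, ← k8.eq]; group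
  · rw [← mul_assoc B13 A13, ← k7.eq]; group
  · rw [← mul_assoc B12, ← k6.eq]; group
lemma q3 : S1 * S2 * S1 = S2 * S1 * S2 := by
  refine Equiv.ext fun ⟨w, p⟩ => ?_
  fin_cases w <;> simp [S2, S1, mono, f1, f2, mul_assoc]
  · have h := ext_right k1.eq p
    simp only [mul_assoc] at h
    rw [← h]; group
  · have h := ext_right k3.eq p
    simp only [mul_assoc] at h
    exact h.symm
lemma q4 : S1 * S2 * T1 = T2 * S1 * S2 := by
  refine Equiv.ext fun ⟨w, p⟩ => ?_
  fin_cases w <;> simp [S2, S1, T1, T2, mono, f1, f2, mul_assoc]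
  · have h := ext_right k5.eq p
    have h' := ext_right k3.eq (A23⁻¹ * (B23 * p))
    simp only [mul_assoc, mul_inv_cancel_left] at h h'
    rw [h', h]
  · have h := ext_right k5.eq p
    have h' := ext_right k1.eq p
    simp only [mul_assoc] at h h'
    rw [← h', inv_mul_cancel_left, h]
lemma q5 : S2 * S1 * T2 = T1 * S2 * S1 := by
  refine Equiv.ext fun ⟨w, p⟩ => ?_
  fin_cases w <;> simp [S2, S1, T1, T2, mono, f1, f2, mul_assoc]
  · have h := ext_right (k1.inv_right.mul_right k2).eq p
    simp only [mul_assoc] at h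
    rw [← h, inv_mul_cancel_left]
  · have h := ext_right (k3.inv_right.mul_right k4).eq p
    simp only [mul_assoc] at h
    exact h
  · have h := ext_right k2.eq p
    simp only [mul_assoc] at h
    rw [← h, inv_mul_cancel_left]
  · have h := ext_right k4.eq p
    simp only [mul_assoc] at h
    exact h

/-- The monomial action of `SG3`. -/
def Φ : SG3 →* Equiv.Perm (Fin 6 × P) :=
  PresentedGroup.toGroup (f := ![S1, S2, T1, T2]) (by
    intro r hr
    simp only [sg3Rels, Set.mem_insert_iff, Set.mem_singleton_iff] at hr
    rcases hr with rfl | rfl | rfl | rfl | rfl <;>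
      simp only [map_mul, map_inv, FreeGroup.lift_apply_of, mul_inv_eq_one]
    exacts [q1, q2, q3, q4, q5])

lemma Φσ1 : Φ σ1 = S1 := by simp [Φ, σ1]
lemma Φσ2 : Φ σ2 = S2 := by simp [Φ, σ2]
lemma Φτ1 : Φ τ1 = T1 := by simp [Φ, τ1]
lemma Φτ2 : Φ τ2 = T2 := by simp [Φ, τ2]

/-! ### Relations in `SG3` -/

lemma e1 : τ1 * σ1 = σ1 * τ1 := sr1.symm
lemma e2 : τ2 * σ2 = σ2 * τ2 := sr2.symm
lemma e3 : σ2 * (σ1 * σ2) = σ1 * (σ2 * σ1) := by simpa only [mul_assoc] using sr3.symm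
lemma e4 : τ2 * (σ1 * σ2) = σ1 * (σ2 * τ1) := by simpa only [mul_assoc] using sr4.symm
lemma e5 : τ1 * (σ2 * σ1) = σ2 * (σ1 * τ2) := by simpa only [mul_assoc] using sr5.symm
lemma e1' (t : SG3) : τ1 * (σ1 * t) = σ1 * (τ1 * t) := by
  simpa only [mul_assoc] using ext_right e1 t
lemma e2' (t : SG3) : τ2 * (σ2 * t) = σ2 * (τ2 * t) := by
  simpa only [mul_assoc] using ext_right e2 t
lemma e3' (t : SG3) : σ2 * (σ1 * (σ2 * t)) = σ1 * (σ2 * (σ1 * t)) := by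
  simpa only [mul_assoc] using ext_right e3 t
lemma e4' (t : SG3) : τ2 * (σ1 * (σ2 * t)) = σ1 * (σ2 * (τ1 * t)) := by
  simpa only [mul_assoc] using ext_right e4 t
lemma e5' (t : SG3) : τ1 * (σ2 * (σ1 * t)) = σ2 * (σ1 * (τ2 * t)) := by
  simpa only [mul_assoc] using ext_right e5 t

lemma g1 : Commute (σ2 * (σ1 * (σ1 * σ2))) σ1 := by
  calc σ2 * (σ1 * (σ1 * σ2)) * σ1 = σ2 * (σ1 * (σ1 * (σ2 * σ1))) := by simp only [mul_assoc]
    _ = σ1 * (σ2 * (σ1 * (σ1 * σ2))) := by rw [← e3, e3']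
    _ = _ := by simp only [mul_assoc]
lemma g2 : Commute (σ2 * (σ1 * (σ1 * σ2))) τ1 := by
  have h : τ1 * (σ2 * (σ1 * (σ1 * σ2))) = σ2 * (σ1 * (σ1 * (σ2 * τ1))) := by rw [e5', e4]
  rw [Commute, SemiconjBy, h]; simp only [mul_assoc]

lemma a13' : a13 = σ1⁻¹ * σ2 ^ 2 * σ1 := by
  rw [a13, mul_inv_eq_iff_eq_mul, mul_assoc, mul_assoc, eq_inv_mul_iff_mul_eq]
  simp only [pow_two, mul_assoc, e3, e3']
lemma b13' : b13 = σ1⁻¹ * (σ2 * τ2) * σ1 := by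
  rw [b13, mul_inv_eq_iff_eq_mul, mul_assoc, mul_assoc, mul_assoc, eq_inv_mul_iff_mul_eq]
  simp only [mul_assoc, e4, e3']

lemma s1 : a12 * a13 * a12⁻¹ = a23⁻¹ * a13 * a23 := by
  calc _ = σ1 * σ2 ^ 2 * σ1⁻¹ := by rw [a13', a12]; group
    _ = σ2⁻¹ * σ1 ^ 2 * σ2 := by
      rw [mul_inv_eq_iff_eq_mul, mul_assoc, mul_assoc, eq_inv_mul_iff_mul_eq]
      simp only [pow_two, mul_assoc, e3, e3']
    _ = _ := by rw [a13, a23]; group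
lemma s3 : a12 * b12 = b12 * a12 := by
  simp only [a12, b12, pow_two, mul_assoc, e1, e1']
lemma s4 : a13 * b13 = b13 * a13 := by
  calc _ = σ2 * (a12 * b12) * σ2⁻¹ := by rw [a13, b13, a12, b12]; group
    _ = _ := by rw [s3, a13, b13, a12, b12]; group
lemma s5 : a23 * b23 = b23 * a23 := by
  simp only [a23, b23, pow_two, mul_assoc, e2, e2']
lemma s7' : σ1 * (σ2 * τ2) * σ1⁻¹ = σ2⁻¹ * (σ1 * τ1) * σ2 := by
  rw [mul_inv_eq_iff_eq_mul, mul_assoc, mul_assoc, mul_assoc, eq_inv_mul_iff_mul_eq]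
  simp only [mul_assoc, e5, e3']
lemma s7 : a12 * b13 * a12⁻¹ = a23⁻¹ * b13 * a23 := by
  calc _ = σ1 * (σ2 * τ2) * σ1⁻¹ := by rw [b13', a12]; group
    _ = σ2⁻¹ * (σ1 * τ1) * σ2 := s7'
    _ = _ := by rw [b13, a23]; group
lemma a1323 : a13 * a23 = σ2 * (σ1 * (σ1 * σ2)) := by
  rw [a13, a23]; group; simp only [zpow_two, mul_assoc]
lemma s6 : b12 * (a13 * a23) * b12⁻¹ = a13 * a23 := by
  rw [mul_inv_eq_iff_eq_mul, a1323, b12]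
  exact (g1.mul_right g2).eq.symm

/-- The full twist. -/
def D : SG3 := σ1 * (σ2 * σ1)
lemma D1 : D * σ1 = σ2 * D := by
  simp only [D, mul_assoc, e3']
lemma D2 : D * σ2 = σ1 * D := by
  simp only [D, mul_assoc, e3]
lemma D4 : D * τ2 = τ1 * D := by
  simp only [D, mul_assoc, e1', e5]
lemma D3 : D * τ1 = τ2 * D := by
  simp only [D, mul_assoc, ← e1, e4']
lemma DD : a13 * a23 * a12 = D * D := by
  rw [a1323, a12, (g1.pow_right 2).eq]
  have h := g1.eq
  simp only [mul_assoc] at h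
  simp only [D, pow_two, mul_assoc]
  rw [h]
lemma D22 : Commute (D * D) σ2 := by
  rw [Commute, SemiconjBy, mul_assoc, D2, ← mul_assoc, D1, mul_assoc]
lemma D24 : Commute (D * D) τ2 := by
  rw [Commute, SemiconjBy, mul_assoc, D4, ← mul_assoc, D3, mul_assoc]

lemma s2 : a12 * a23 * a12⁻¹ = a23⁻¹ * a13⁻¹ * a23 * a13 * a23 := by
  calc _ = (a13 * a23)⁻¹ * a23 * (a13 * a23) := by
        rw [mul_inv_eq_iff_eq_mul, mul_assoc, mul_assoc, eq_inv_mul_iff_mul_eq, ← mul_assoc, DD]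
        exact (D22.pow_right 2).eq
    _ = _ := by group
lemma s8 : a12 * b23 * a12⁻¹ = a23⁻¹ * a13⁻¹ * b23 * a13 * a23 := by
  calc _ = (a13 * a23)⁻¹ * b23 * (a13 * a23) := by
        rw [mul_inv_eq_iff_eq_mul, mul_assoc, mul_assoc, eq_inv_mul_iff_mul_eq, ← mul_assoc, DD]
        exact (D22.mul_right D24).eq
    _ = _ := by group

/-- The candidate isomorphism, as a homomorphism into `SG3`. -/
def ι : P →* SG3 :=
  PresentedGroup.toGroup (f := ![a12, a13, a23, b12, b13, b23]) (by
    intro r hr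
    simp only [sp3Rels, Set.mem_insert_iff, Set.mem_singleton_iff] at hr
    rcases hr with rfl | rfl | rfl | rfl | rfl | rfl | rfl | rfl <;>
      simp only [map_mul, map_inv, FreeGroup.lift_apply_of, mul_inv_eq_one]
    exacts [s1, s2, s3, s4, s5, s6, s7, s8])

lemma ι0 : ι A12 = a12 := by simp [ι, A12]
lemma ι1 : ι A13 = a13 := by simp [ι, A13]
lemma ι2 : ι A23 = a23 := by simp [ι, A23]
lemma ι3 : ι B12 = b12 := by simp [ι, B12]
lemma ι4 : ι B13 = b13 := by simp [ι, B13]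
lemma ι5 : ι B23 = b23 := by simp [ι, B23]

/-- Induction over a subgroup of `P` containing the generators. -/
lemma P_top (H : Subgroup P) (h0 : A12 ∈ H) (h1 : A13 ∈ H) (h2 : A23 ∈ H)
    (h3 : B12 ∈ H) (h4 : B13 ∈ H) (h5 : B23 ∈ H) (x : P) : x ∈ H := by
  have : (⊤ : Subgroup P) ≤ H := by
    rw [← PresentedGroup.closure_range_of, Subgroup.closure_le]
    rintro _ ⟨i, rfl⟩
    fin_cases i <;> assumption
  exact this trivial

lemma SG_top (H : Subgroup SG3) (h0 : σ1 ∈ H) (h1 : σ2 ∈ H) (h2 : τ1 ∈ H)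
    (h3 : τ2 ∈ H) (x : SG3) : x ∈ H := by
  have : (⊤ : Subgroup SG3) ≤ H := by
    rw [← PresentedGroup.closure_range_of, Subgroup.closure_le]
    rintro _ ⟨i, rfl⟩
    fin_cases i <;> assumption
  exact this trivial

/-- Elements `x` of `P` such that `ι x` acts on the base fibre by left translation. -/
def good : Subgroup P where
  carrier := {x | ∀ p, Φ (ι x) (0, p) = (0, x * p)}
  one_mem' := by intro p; simp
  mul_mem' := by intro a b ha hb p; simp at *; simp [ha, hb, mul_assoc]
  inv_mem' := by
    intro a ha p
    rw [map_inv, map_inv, Equiv.Perm.inv_eq_iff_eq, ha]; simp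

lemma Φι (x p : P) : Φ (ι x) (0, p) = (0, x * p) := by
  refine P_top good ?_ ?_ ?_ ?_ ?_ ?_ x p
  · intro p
    simp [ι0, a12, Φσ1, S1, mono, f1, pow_two]
  · intro p
    rw [ι1, a13, map_mul, map_inv, Equiv.Perm.mul_apply]
    have : (Φ σ2)⁻¹ (0, p) = (2, A23⁻¹ * p) := by
      rw [Equiv.Perm.inv_eq_iff_eq]; simp [Φσ2, S2, mono, f2]
    rw [this]
    simp [Φσ1, Φσ2, S1, S2, mono, f1, f2, pow_two, mul_assoc]
  · intro p
    simp [ι2, a23, Φσ2, S2, mono, f2, pow_two]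
  · intro p
    simp [ι3, b12, Φσ1, Φτ1, S1, T1, mono, f1, mul_assoc]
  · intro p
    rw [ι4, b13, map_mul, map_inv, Equiv.Perm.mul_apply]
    have : (Φ σ2)⁻¹ (0, p) = (2, A23⁻¹ * p) := by
      rw [Equiv.Perm.inv_eq_iff_eq]; simp [Φσ2, S2, mono, f2]
    rw [this]
    simp [Φσ1, Φσ2, Φτ1, S1, S2, T1, mono, f1, f2, mul_assoc]
  · intro p
    simp [ι5, b23, Φσ2, Φτ2, S2, T2, mono, f2, mul_assoc]

lemma ι_inj : Function.Injective ι := by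
  intro x y h
  have hx := Φι x 1
  rw [h, Φι y 1] at hx
  simpa using hx.symm

/-- Coset representatives. -/
def rep : Fin 6 → SG3 := ![1, σ1, σ2, σ1 * σ2, σ2 * σ1, σ1 * σ2 * σ1]

def ev (x : Fin 6 × P) : SG3 := rep x.1 * ι x.2

/-- Elements whose left translation is modelled by the monomial action. -/
def modelled : Subgroup SG3 where
  carrier := {g | ∀ x, g * ev x = ev (Φ g x)}
  one_mem' := by intro x; simp
  mul_mem' := by intro a b ha hb p; simp at *; simp [← ha, ← hb, mul_assoc]
  inv_mem' := by
    intro a ha x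
    have := ha ((Φ a)⁻¹ x)
    rw [← Equiv.Perm.mul_apply, mul_inv_cancel, Equiv.Perm.one_apply] at this
    rw [map_inv, inv_mul_eq_iff_eq_mul]
    exact this.symm

lemma rw_aux (g r s c : SG3) (p : SG3) (h : g * r = s * c) : g * (r * p) = s * (c * p) := by
  rw [← mul_assoc, h, mul_assoc]

lemma m1 : σ1 ∈ modelled := by
  rintro ⟨w, p⟩
  rw [Φσ1]
  simp only [ev, S1, mono, Equiv.coe_fn_mk, map_mul]
  apply rw_aux
  fin_cases w <;> simp [rep, f1, ι0, ι1, ι2, ι3, ι4, ι5]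
  · rw [a12, pow_two]
  · rw [a13, a23]; group; simp only [zpow_two]
  · simp only [mul_assoc]
  · rw [a23, pow_two]; simp only [mul_assoc, e3']; rw [← e3]
lemma m2 : σ2 ∈ modelled := by
  rintro ⟨w, p⟩
  rw [Φσ2]
  simp only [ev, S2, mono, Equiv.coe_fn_mk, map_mul]
  apply rw_aux
  fin_cases w <;> simp [rep, f2, ι0, ι1, ι2, ι3, ι4, ι5]
  · rw [a23, pow_two]
  · rw [e3, mul_assoc]
  · rw [a13']; group; simp only [zpow_two]
  · rw [a12, pow_two]; simp only [mul_assoc, e3']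
lemma m3 : τ1 ∈ modelled := by
  rintro ⟨w, p⟩
  rw [Φτ1]
  simp only [ev, T1, mono, Equiv.coe_fn_mk, map_mul]
  apply rw_aux
  fin_cases w <;> simp [rep, f1, ι0, ι1, ι2, ι3, ι4, ι5]
  · rw [a12, b12]; group
  · rw [b12, e1]
  · calc _ = σ1⁻¹ * (σ1 * τ1) * σ2 := by group
      _ = _ := by rw [a13, a23, b13]; group
  · rw [a23, b13, ← mul_assoc, e1]; group
  · rw [a23, b23, e5, mul_assoc σ1, ← e3]; group
  · rw [b23]; simp only [mul_assoc, e1', e5]; rw [e3']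
lemma m4 : τ2 ∈ modelled := by
  rintro ⟨w, p⟩
  rw [Φτ2]
  simp only [ev, T2, mono, Equiv.coe_fn_mk, map_mul]
  apply rw_aux
  fin_cases w <;> simp [rep, f2, ι0, ι1, ι2, ι3, ι4, ι5]
  · rw [a23, b23]; group
  · rw [a13', b13']; group
  · rw [b23, e2]
  · rw [e4, a12, b12]; group
  · rw [b13']; simp only [mul_assoc, mul_inv_cancel_left, e2']
  · rw [b12]; simp only [mul_assoc, e4', e1]

end SPthree

open SPthree in
/-- The group presented by the eight relations above is isomorphic to
`SP₃ = ker π ≤ SG₃`, via `A₁₂ ↦ a₁₂`, ..., `B₂₃ ↦ b₂₃`. -/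
theorem stmt4 (π : SG3 →* Equiv.Perm (Fin 3))
    (hσ1 : π σ1 = Equiv.swap 0 1) (hτ1 : π τ1 = Equiv.swap 0 1)
    (hσ2 : π σ2 = Equiv.swap 1 2) (hτ2 : π τ2 = Equiv.swap 1 2) :
    ∃ e : PresentedGroup sp3Rels ≃* MonoidHom.ker π,
      (e (PresentedGroup.of 0) : SG3) = a12 ∧
      (e (PresentedGroup.of 1) : SG3) = a13 ∧
      (e (PresentedGroup.of 2) : SG3) = a23 ∧
      (e (PresentedGroup.of 3) : SG3) = b12 ∧
      (e (PresentedGroup.of 4) : SG3) = b13 ∧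
      (e (PresentedGroup.of 5) : SG3) = b23 := by
  have hker : ∀ x : P, ι x ∈ π.ker := by
    intro x
    refine P_top (π.ker.comap ι) ?_ ?_ ?_ ?_ ?_ ?_ x <;>
      simp only [Subgroup.mem_comap, ι0, ι1, ι2, ι3, ι4, ι5, a12, a13, a23, b12, b13, b23,
        MonoidHom.mem_ker, map_mul, map_inv, map_pow, hσ1, hσ2, hτ1, hτ2] <;> decide
  have hrep : ∀ w, π (rep w) = 1 → w = 0 := by
    intro w
    fin_cases w <;> simp [rep, hσ1, hσ2] <;> decide
  have hbij : Function.Bijective (ι.codRestrict π.ker hker) := by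
    constructor
    · intro x y h
      exact ι_inj (congrArg Subtype.val h)
    · rintro ⟨k, hk⟩
      have h : k * ev (0, 1) = ev (Φ k (0, 1)) := SG_top modelled m1 m2 m3 m4 k (0, 1)
      generalize Φ k (0, 1) = x at h
      obtain ⟨w, p⟩ := x
      have h1 : k = rep w * ι p := by simpa [ev, rep] using h
      have hw : w = 0 := by
        apply hrep
        have h2 := congrArg π h1
        rw [map_mul, (hker p : π (ι p) = 1), (hk : π k = 1), mul_one] at h2
        exact h2.symm
      subst hw
      exact ⟨p, Subtype.ext (by simp [h1, rep])⟩
  exact ⟨MulEquiv.ofBijective _ hbij, ι0, ι1, ι2, ι3, ι4, ι5⟩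
end

section
/- Let H be the group with presentation ⟨A13, A23, B13, B23, B12 | A13·B13 = B13·A13, A23·B23 = B23·A23, B12·(A13·A23)·B12⁻¹ = A13·A23⟩. Let G be the free product (ℤ×ℤ) * (ℤ×ℤ), let c ∈ G be the product of the element (1,0) of the first free factor with the element (1,0) of the second free factor, let A = B be the cyclic subgroup of G generated by c, and let φ : A → B be the identity isomorphism. Then H is isomorphic to the HNN extension of G with associated subgroups A, B and isomorphism φ (with stable letter corresponding to B12, the first factor's generators (1,0), (0,1) corresponding to A13, B13, and the second factor's generators (1,0), (0,1) corresponding to A23, B23). -/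
/-- Defining relations of `Ṽ₃` on the generators
`0 ↦ A₁₃`, `1 ↦ A₂₃`, `2 ↦ B₁₃`, `3 ↦ B₂₃`, `4 ↦ B₁₂`. -/
def v3Rels : Set (FreeGroup (Fin 5)) :=
  {FreeGroup.of 0 * FreeGroup.of 2 * (FreeGroup.of 2 * FreeGroup.of 0)⁻¹,
   FreeGroup.of 1 * FreeGroup.of 3 * (FreeGroup.of 3 * FreeGroup.of 1)⁻¹,
   FreeGroup.of 4 * (FreeGroup.of 0 * FreeGroup.of 1) * (FreeGroup.of 4)⁻¹ *
     (FreeGroup.of 0 * FreeGroup.of 1)⁻¹}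

/-- The free product `(ℤ×ℤ) ∗ (ℤ×ℤ)`. -/
abbrev V3base : Type := Monoid.Coprod (Multiplicative (ℤ × ℤ)) (Multiplicative (ℤ × ℤ))

/-- The element `a₁₃a₂₃`, the product of the generators `(1,0)` of the two factors. -/
def cElt : V3base :=
  Monoid.Coprod.inl (Multiplicative.ofAdd ((1 : ℤ), (0 : ℤ))) *
    Monoid.Coprod.inr (Multiplicative.ofAdd ((1 : ℤ), (0 : ℤ)))

/-- The hom from `ℤ × ℤ` determined by a commuting pair. -/
def zzHom {H : Type*} [Group H] (x y : H) (h : Commute x y) : Multiplicative (ℤ × ℤ) →* H where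
  toFun m := x ^ (Multiplicative.toAdd m).1 * y ^ (Multiplicative.toAdd m).2
  map_one' := by simp
  map_mul' a b := by
    have h1 : Commute (x ^ (Multiplicative.toAdd b).1) (y ^ (Multiplicative.toAdd a).2) :=
      h.zpow_zpow _ _
    simp only [toAdd_mul, Prod.fst_add, Prod.snd_add, zpow_add]
    simp only [mul_assoc]
    congr 1
    simp only [← mul_assoc]
    rw [h1.eq]

theorem zzHom_fst {H : Type*} [Group H] (x y : H) (h : Commute x y) :
    zzHom x y h (Multiplicative.ofAdd ((1 : ℤ), (0 : ℤ))) = x := by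
  simp [zzHom]

theorem zzHom_snd {H : Type*} [Group H] (x y : H) (h : Commute x y) :
    zzHom x y h (Multiplicative.ofAdd ((0 : ℤ), (1 : ℤ))) = y := by
  simp [zzHom]

theorem zz_ext {H : Type*} [Group H] {f g : Multiplicative (ℤ × ℤ) →* H}
    (h1 : f (Multiplicative.ofAdd ((1 : ℤ), (0 : ℤ))) = g (Multiplicative.ofAdd ((1 : ℤ), (0 : ℤ))))
    (h2 : f (Multiplicative.ofAdd ((0 : ℤ), (1 : ℤ))) = g (Multiplicative.ofAdd ((0 : ℤ), (1 : ℤ)))) :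
    f = g := by
  apply MonoidHom.ext
  intro m
  have hm : m = Multiplicative.ofAdd ((1 : ℤ), (0 : ℤ)) ^ (Multiplicative.toAdd m).1 *
      Multiplicative.ofAdd ((0 : ℤ), (1 : ℤ)) ^ (Multiplicative.toAdd m).2 := by
    apply Multiplicative.toAdd.injective
    simp
  rw [hm, map_mul, map_mul, map_zpow, map_zpow, map_zpow, map_zpow, h1, h2]

/-- The HNN extension. -/
abbrev V3HNN : Type := HNNExtension V3base (Subgroup.zpowers cElt) (Subgroup.zpowers cElt)
  (MulEquiv.refl (Subgroup.zpowers cElt))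

/-- Images of the generators. -/
def v3Gen : Fin 5 → V3HNN :=
  ![HNNExtension.of (Monoid.Coprod.inl (Multiplicative.ofAdd ((1 : ℤ), (0 : ℤ)))),
    HNNExtension.of (Monoid.Coprod.inr (Multiplicative.ofAdd ((1 : ℤ), (0 : ℤ)))),
    HNNExtension.of (Monoid.Coprod.inl (Multiplicative.ofAdd ((0 : ℤ), (1 : ℤ)))),
    HNNExtension.of (Monoid.Coprod.inr (Multiplicative.ofAdd ((0 : ℤ), (1 : ℤ)))),
    HNNExtension.t]

theorem v3Gen_rels : ∀ r ∈ v3Rels, FreeGroup.lift v3Gen r = 1 := by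
  rintro r (rfl | rfl | rfl)
  · simp only [map_mul, map_inv, FreeGroup.lift_apply_of, mul_inv_eq_one]
    simp only [v3Gen, Matrix.cons_val]
    exact ((Commute.all _ _).map Monoid.Coprod.inl).map HNNExtension.of
  · simp only [map_mul, map_inv, FreeGroup.lift_apply_of, mul_inv_eq_one]
    simp only [v3Gen, Matrix.cons_val]
    exact ((Commute.all _ _).map Monoid.Coprod.inr).map HNNExtension.of
  · simp only [map_mul, map_inv, FreeGroup.lift_apply_of, mul_inv_eq_one]
    simp only [v3Gen, Matrix.cons_val]
    rw [← map_mul]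
    exact (HNNExtension.equiv_eq_conj (φ := MulEquiv.refl (Subgroup.zpowers cElt))
      ⟨cElt, Subgroup.mem_zpowers cElt⟩).symm

/-- Forward map. -/
def v3Fwd : PresentedGroup v3Rels →* V3HNN := PresentedGroup.toGroup v3Gen_rels

theorem v3Fwd_of (i : Fin 5) : v3Fwd (PresentedGroup.of i) = v3Gen i :=
  PresentedGroup.toGroup.of v3Gen_rels

theorem v3_comm1 : Commute (PresentedGroup.of 0 : PresentedGroup v3Rels) (PresentedGroup.of 2) := by
  have h := PresentedGroup.one_of_mem (rels := v3Rels) (Or.inl rfl)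
  simp only [map_mul, map_inv, mul_inv_eq_one] at h
  exact h

theorem v3_comm2 : Commute (PresentedGroup.of 1 : PresentedGroup v3Rels) (PresentedGroup.of 3) := by
  have h := PresentedGroup.one_of_mem (rels := v3Rels) (Or.inr (Or.inl rfl))
  simp only [map_mul, map_inv, mul_inv_eq_one] at h
  exact h

theorem v3_comm3 : Commute (PresentedGroup.of 4 : PresentedGroup v3Rels)
    (PresentedGroup.of 0 * PresentedGroup.of 1) := by
  have h := PresentedGroup.one_of_mem (rels := v3Rels) (Or.inr (Or.inr rfl))
  simp only [map_mul, map_inv, mul_inv_eq_one] at h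
  exact mul_inv_eq_iff_eq_mul.mp h

/-- Backward map on the base. -/
def v3BwdBase : V3base →* PresentedGroup v3Rels :=
  Monoid.Coprod.lift (zzHom _ _ v3_comm1) (zzHom _ _ v3_comm2)

theorem v3BwdBase_cElt : v3BwdBase cElt = PresentedGroup.of 0 * PresentedGroup.of 1 := by
  simp only [v3BwdBase, cElt, map_mul, Monoid.Coprod.lift_apply_inl, Monoid.Coprod.lift_apply_inr,
    zzHom_fst]

/-- Backward map. -/
def v3Bwd : V3HNN →* PresentedGroup v3Rels :=
  HNNExtension.lift v3BwdBase (PresentedGroup.of 4) (by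
    rintro ⟨a, ha⟩
    obtain ⟨n, rfl⟩ := Subgroup.mem_zpowers_iff.mp ha
    simp only [MulEquiv.refl_apply, map_zpow, v3BwdBase_cElt]
    exact (v3_comm3.zpow_right n).eq)

theorem v3Bwd_gen (i : Fin 5) : v3Bwd (v3Gen i) = PresentedGroup.of i := by
  fin_cases i <;> simp [v3Gen, v3Bwd, v3BwdBase, zzHom_fst, zzHom_snd]

theorem v3_left : v3Bwd.comp v3Fwd = MonoidHom.id _ := by
  apply PresentedGroup.ext
  intro i
  simp [v3Fwd_of, v3Bwd_gen]

theorem v3_right : v3Fwd.comp v3Bwd = MonoidHom.id _ := by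
  have key : ∀ i, v3Fwd (v3Bwd (v3Gen i)) = v3Gen i := fun i => by
    rw [v3Bwd_gen, v3Fwd_of]
  apply HNNExtension.hom_ext
  · apply Monoid.Coprod.hom_ext
    · exact zz_ext (key 0) (key 2)
    · exact zz_ext (key 1) (key 3)
  · exact key 4

/-- `Ṽ₃` is the HNN-extension of `(ℤ×ℤ) ∗ (ℤ×ℤ)` with associated subgroups
`A = B = ⟨a₁₃a₂₃⟩` and identity isomorphism, with stable letter `B₁₂`. -/
theorem stmt12 :
    ∃ e : PresentedGroup v3Rels ≃*
        HNNExtension V3base (Subgroup.zpowers cElt) (Subgroup.zpowers cElt)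
          (MulEquiv.refl (Subgroup.zpowers cElt)),
      e (PresentedGroup.of 4) = HNNExtension.t ∧
      e (PresentedGroup.of 0) =
        HNNExtension.of (Monoid.Coprod.inl (Multiplicative.ofAdd ((1 : ℤ), (0 : ℤ)))) ∧
      e (PresentedGroup.of 2) =
        HNNExtension.of (Monoid.Coprod.inl (Multiplicative.ofAdd ((0 : ℤ), (1 : ℤ)))) ∧
      e (PresentedGroup.of 1) =
        HNNExtension.of (Monoid.Coprod.inr (Multiplicative.ofAdd ((1 : ℤ), (0 : ℤ)))) ∧
      e (PresentedGroup.of 3) =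
        HNNExtension.of (Monoid.Coprod.inr (Multiplicative.ofAdd ((0 : ℤ), (1 : ℤ)))) := by
  exact ⟨MonoidHom.toMulEquiv v3Fwd v3Bwd v3_left v3_right,
    v3Fwd_of 4, v3Fwd_of 0, v3Fwd_of 2, v3Fwd_of 1, v3Fwd_of 3⟩
end

section
/- The subgroup V_3 of SG_3 generated by the four elements a13 = σ2σ1²σ2⁻¹, a23 = σ2², b13 = σ2σ1τ1σ2⁻¹, b23 = σ2τ2 is isomorphic to the free product (ℤ×ℤ) * (ℤ×ℤ), via an isomorphism sending the generators (1,0) and (0,1) of the first free factor to a13 and b13, and the generators (1,0) and (0,1) of the second free factor to a23 and b23. -/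
namespace SG3Proof

/-- The free product `ℤ² ∗ ℤ²`. -/
abbrev FP : Type := Monoid.Coprod (Multiplicative (ℤ × ℤ)) (Multiplicative (ℤ × ℤ))

/-- Homomorphism from `ℤ²` given by two commuting elements. -/
def zz {G : Type*} [Group G] (a b : G) (h : Commute a b) : Multiplicative (ℤ × ℤ) →* G where
  toFun x := a ^ (Multiplicative.toAdd x).1 * b ^ (Multiplicative.toAdd x).2
  map_one' := by simp
  map_mul' x y := by
    have h1 := (h.zpow_zpow (Multiplicative.toAdd y).1 (Multiplicative.toAdd x).2).eq
    simp only [toAdd_mul, Prod.fst_add, Prod.snd_add, zpow_add]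
    rw [mul_assoc, mul_assoc, ← mul_assoc (a ^ (Multiplicative.toAdd y).1), h1]
    simp only [mul_assoc]

/-- Monomial permutation of `Fin 6 × F`. -/
def mono {F : Type*} [Group F] (p : Equiv.Perm (Fin 6)) (c : Fin 6 → F) :
    Equiv.Perm (Fin 6 × F) where
  toFun x := (p x.1, c x.1 * x.2)
  invFun x := (p.symm x.1, (c (p.symm x.1))⁻¹ * x.2)
  left_inv x := by simp
  right_inv x := by simp

theorem mono_mul {F : Type*} [Group F] (p q : Equiv.Perm (Fin 6)) (c d : Fin 6 → F) :
    mono p c * mono q d = mono (p * q) (fun i => c (q i) * d i) := by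
  ext x <;> simp [mono, mul_assoc]

/-- Left multiplication by `σ₁` on `S₃`. -/
def p1 : Equiv.Perm (Fin 6) :=
  ⟨![1, 0, 3, 2, 5, 4], ![1, 0, 3, 2, 5, 4], by decide, by decide⟩

/-- Left multiplication by `σ₂` on `S₃`. -/
def p2 : Equiv.Perm (Fin 6) :=
  ⟨![2, 4, 0, 5, 1, 3], ![2, 4, 0, 5, 1, 3], by decide, by decide⟩

section
variable {F : Type*} [Group F] (A B C D : F)

def s1 : Equiv.Perm (Fin 6 × F) := mono p1 ![1, (A * C)⁻¹, 1, C⁻¹ * A * C, 1, C]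
def s2 : Equiv.Perm (Fin 6 × F) := mono p2 ![1, 1, C, 1, A, (A * C)⁻¹]
def β1 : Equiv.Perm (Fin 6 × F) := mono 1 ![1, 1, C⁻¹ * B * C, C⁻¹ * B * C, D, D]
def β2 : Equiv.Perm (Fin 6 × F) := mono 1 ![D, B, D, 1, B, 1]

theorem mono_ext {p q : Equiv.Perm (Fin 6)} {c d : Fin 6 → F} (h : ∀ i, p i = q i)
    (h' : ∀ i, c i = d i) : mono p c = mono q d := by
  rw [Equiv.ext h, funext h']

theorem r1 (h : Commute A B) (h' : Commute C D) :
    s1 A C * β1 B C D = β1 B C D * s1 A C := by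
  simp only [s1, β1, mono_mul]
  refine mono_ext (by decide) (fun i => ?_)
  have := h.eq
  have := h'.eq
  fin_cases i <;> simp [p1, mul_assoc] <;> simp_all [← mul_assoc]

theorem r2 (h : Commute A B) (h' : Commute C D) :
    s2 A C * β2 B D = β2 B D * s2 A C := by
  simp only [s2, β2, mono_mul]
  refine mono_ext (by decide) (fun i => ?_)
  have := h.eq
  have := h'.eq
  fin_cases i <;> simp [p2, mul_assoc] <;> simp_all [← mul_assoc]

theorem r3 : s1 A C * s2 A C * s1 A C = s2 A C * s1 A C * s2 A C := by
  simp only [s1, s2, mono_mul]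
  refine mono_ext (by decide) (fun i => ?_)
  fin_cases i <;> simp [p1, p2, mul_assoc]

theorem r4 (h : Commute A B) (h' : Commute C D) :
    s1 A C * s2 A C * β1 B C D = β2 B D * (s1 A C * s2 A C) := by
  simp only [s1, s2, β1, β2, mono_mul]
  refine mono_ext (by decide) (fun i => ?_)
  have := h.eq
  have := h'.eq
  fin_cases i <;> simp [p1, p2, mul_assoc]
  all_goals exact h'.inv_left.eq

theorem r5 (h : Commute A B) (h' : Commute C D) :
    s2 A C * s1 A C * β2 B D = β1 B C D * (s2 A C * s1 A C) := by
  simp only [s1, s2, β1, β2, mono_mul]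
  refine mono_ext (by decide) (fun i => ?_)
  have := h.eq
  have := h'.eq
  fin_cases i <;> simp [p1, p2, mul_assoc]
  all_goals exact h.inv_left.eq

theorem tw {G : Type*} [Group G] {s t b c : G} (h3 : s * t * s = t * s * t)
    (h4 : s * t * b = c * (s * t)) : s * t * (s⁻¹ * b) = t⁻¹ * c * s * t := by
  have e : s * t * s⁻¹ = t⁻¹ * s * t := by
    rw [mul_inv_eq_iff_eq_mul]
    rw [show t⁻¹ * s * t * s = t⁻¹ * (s * t * s) by group, h3]; group
  calc s * t * (s⁻¹ * b) = (s * t * s⁻¹) * b := by group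
    _ = t⁻¹ * (s * t * b) := by rw [e]; group
    _ = _ := by rw [h4]; group

theorem cm {G : Type*} [Group G] {s b : G} (h : s * b = b * s) :
    s * (s⁻¹ * b) = s⁻¹ * b * s := by
  rw [mul_assoc, ← h]; group

/-- The generators of the representation. -/
def gens : Fin 4 → Equiv.Perm (Fin 6 × F) :=
  ![s1 A C, s2 A C, (s1 A C)⁻¹ * β1 B C D, (s2 A C)⁻¹ * β2 B D]

theorem gens_rels (h : Commute A B) (h' : Commute C D) :
    ∀ r ∈ sg3Rels, FreeGroup.lift (gens A B C D) r = 1 := by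
  intro r hr
  simp only [sg3Rels, Set.mem_insert_iff, Set.mem_singleton_iff] at hr
  have h3 := r3 A C
  rcases hr with rfl | rfl | rfl | rfl | rfl <;>
    simp only [map_mul, map_inv, FreeGroup.lift_apply_of, mul_inv_eq_one]
  · exact cm (r1 A B C D h h')
  · exact cm (r2 A B C D h h')
  · exact h3
  · exact tw h3 (r4 A B C D h h')
  · exact tw h3.symm (r5 A B C D h h')

/-- The representation. -/
def rep (h : Commute A B) (h' : Commute C D) : SG3 →* Equiv.Perm (Fin 6 × F) :=
  PresentedGroup.toGroup (gens_rels A B C D h h')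

variable (h : Commute A B) (h' : Commute C D)

theorem rep_σ1 : rep A B C D h h' σ1 = s1 A C := PresentedGroup.toGroup.of _
theorem rep_σ2 : rep A B C D h h' σ2 = s2 A C := PresentedGroup.toGroup.of _
theorem rep_τ1 : rep A B C D h h' τ1 = (s1 A C)⁻¹ * β1 B C D := PresentedGroup.toGroup.of _
theorem rep_τ2 : rep A B C D h h' τ2 = (s2 A C)⁻¹ * β2 B D := PresentedGroup.toGroup.of _

theorem rep_a13 (f : F) : rep A B C D h h' a13 (0, f) = (0, A * f) := by
  simp only [a13, map_mul, map_inv, map_pow, rep_σ1, rep_σ2, pow_two, Equiv.Perm.mul_apply]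
  have : (s2 A C)⁻¹ (0, f) = (2, C⁻¹ * f) := by
    rw [Equiv.Perm.inv_eq_iff_eq]; simp [s2, mono, p2]
  rw [this]; simp [s1, s2, mono, p1, p2, mul_assoc]

theorem rep_b13 (f : F) : rep A B C D h h' b13 (0, f) = (0, B * f) := by
  simp only [b13, map_mul, map_inv, rep_σ1, rep_σ2, rep_τ1, Equiv.Perm.mul_apply]
  have : (s2 A C)⁻¹ (0, f) = (2, C⁻¹ * f) := by
    rw [Equiv.Perm.inv_eq_iff_eq]; simp [s2, mono, p2]
  rw [this, ← Equiv.Perm.mul_apply (s1 A C) (s1 A C)⁻¹, mul_inv_cancel, Equiv.Perm.one_apply]; simp [β1, s2, mono, p2, mul_assoc]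

theorem rep_a23 (f : F) : rep A B C D h h' a23 (0, f) = (0, C * f) := by
  simp only [a23, map_mul, rep_σ2, pow_two, Equiv.Perm.mul_apply]
  simp [s2, mono, p2]

theorem rep_b23 (f : F) : rep A B C D h h' b23 (0, f) = (0, D * f) := by
  simp only [b23, map_mul, rep_σ2, rep_τ2, Equiv.Perm.mul_apply, ← Equiv.Perm.mul_apply (s2 A C) (s2 A C)⁻¹, mul_inv_cancel, Equiv.Perm.one_apply]
  simp [β2, mono]

end

theorem comm1 : σ1 * τ1 = τ1 * σ1 := by
  have := PresentedGroup.one_of_mem (rels := sg3Rels)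
    (x := FreeGroup.of 0 * FreeGroup.of 2 * (FreeGroup.of 2 * FreeGroup.of 0)⁻¹)
    (by simp [sg3Rels])
  simp only [map_mul, map_inv, mul_inv_eq_one] at this
  exact this

theorem comm2 : σ2 * τ2 = τ2 * σ2 := by
  have := PresentedGroup.one_of_mem (rels := sg3Rels)
    (x := FreeGroup.of 1 * FreeGroup.of 3 * (FreeGroup.of 3 * FreeGroup.of 1)⁻¹)
    (by simp [sg3Rels])
  simp only [map_mul, map_inv, mul_inv_eq_one] at this
  exact this

theorem ca : Commute a13 b13 := by
  have h : Commute (σ1 ^ 2) (σ1 * τ1) :=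
    ((Commute.refl σ1).mul_right comm1).pow_left 2
  have := h.map (MulAut.conj σ2)
  simpa [a13, b13, mul_assoc] using this

theorem cb : Commute a23 b23 := ((Commute.refl σ2).mul_right comm2).pow_left 2

/-- The homomorphism from the free product. -/
def ψ : FP →* SG3 := Monoid.Coprod.lift (zz a13 b13 ca) (zz a23 b23 cb)

abbrev e1 : Multiplicative (ℤ × ℤ) := Multiplicative.ofAdd ((1 : ℤ), (0 : ℤ))
abbrev e2 : Multiplicative (ℤ × ℤ) := Multiplicative.ofAdd ((0 : ℤ), (1 : ℤ))

theorem decomp (x : Multiplicative (ℤ × ℤ)) :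
    x = e1 ^ (Multiplicative.toAdd x).1 * e2 ^ (Multiplicative.toAdd x).2 := by
  apply Multiplicative.toAdd.injective
  ext <;> simp [e1, e2]

/-- The standard generators. -/
theorem closure_gens : Subgroup.closure ({Monoid.Coprod.inl e1, Monoid.Coprod.inr e1,
    Monoid.Coprod.inl e2, Monoid.Coprod.inr e2} : Set FP) = ⊤ := by
  rw [eq_top_iff]
  rintro x -
  induction x using Monoid.Coprod.induction_on with
  | inl m =>
    rw [decomp m, map_mul, map_zpow, map_zpow]
    exact mul_mem (zpow_mem (Subgroup.subset_closure (by simp)) _)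
      (zpow_mem (Subgroup.subset_closure (by simp)) _)
  | inr m =>
    rw [decomp m, map_mul, map_zpow, map_zpow]
    exact mul_mem (zpow_mem (Subgroup.subset_closure (by simp)) _)
      (zpow_mem (Subgroup.subset_closure (by simp)) _)
  | mul x y hx hy => exact mul_mem hx hy

theorem ψ1 : ψ (Monoid.Coprod.inl e1) = a13 := by simp [ψ, zz, e1]
theorem ψ2 : ψ (Monoid.Coprod.inl e2) = b13 := by simp [ψ, zz, e2]
theorem ψ3 : ψ (Monoid.Coprod.inr e1) = a23 := by simp [ψ, zz, e1]
theorem ψ4 : ψ (Monoid.Coprod.inr e2) = b23 := by simp [ψ, zz, e2]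

theorem ψ_range : ψ.range = Subgroup.closure {a13, a23, b13, b23} := by
  rw [MonoidHom.range_eq_map, ← closure_gens, MonoidHom.map_closure]
  simp only [Set.image_insert_eq, Set.image_singleton, ψ1, ψ2, ψ3, ψ4]

theorem cE : Commute e1 e2 := Commute.all _ _

/-- The representation on `Fin 6 × FP`. -/
def R : SG3 →* Equiv.Perm (Fin 6 × FP) :=
  rep (Monoid.Coprod.inl e1) (Monoid.Coprod.inl e2) (Monoid.Coprod.inr e1)
    (Monoid.Coprod.inr e2) (cE.map Monoid.Coprod.inl) (cE.map Monoid.Coprod.inr)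

theorem R_ψ (x : FP) : ∀ f, R (ψ x) (0, f) = (0, x * f) := by
  have hx : x ∈ Subgroup.closure ({Monoid.Coprod.inl e1, Monoid.Coprod.inr e1,
    Monoid.Coprod.inl e2, Monoid.Coprod.inr e2} : Set FP) := by
    rw [closure_gens]; trivial
  induction hx using Subgroup.closure_induction with
  | mem y hy =>
    intro f
    simp only [Set.mem_insert_iff, Set.mem_singleton_iff] at hy
    rcases hy with rfl | rfl | rfl | rfl
    · rw [ψ1]; exact rep_a13 _ _ _ _ _ _ f
    · rw [ψ3]; exact rep_a23 _ _ _ _ _ _ f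
    · rw [ψ2]; exact rep_b13 _ _ _ _ _ _ f
    · rw [ψ4]; exact rep_b23 _ _ _ _ _ _ f
  | one => intro f; simp
  | mul x y _ _ hx hy => intro f; rw [map_mul, map_mul, Equiv.Perm.mul_apply, hy, hx, mul_assoc]
  | inv x _ hx =>
    intro f
    rw [map_inv, map_inv, Equiv.Perm.inv_eq_iff_eq, hx, mul_inv_cancel_left]

theorem ψ_inj : Function.Injective ψ := by
  rw [injective_iff_map_eq_one]
  intro x hx
  have := R_ψ x 1
  rw [hx] at this
  simpa using this.symm

end SG3Proof

/-- The subgroup `V₃ = ⟨a₁₃, a₂₃, b₁₃, b₂₃⟩` of `SG₃` is isomorphic to the free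
product `(ℤ×ℤ) ∗ (ℤ×ℤ)`. -/
theorem stmt13 :
    ∃ e : Monoid.Coprod (Multiplicative (ℤ × ℤ)) (Multiplicative (ℤ × ℤ)) ≃*
        Subgroup.closure {a13, a23, b13, b23},
      (e (Monoid.Coprod.inl (Multiplicative.ofAdd ((1 : ℤ), (0 : ℤ)))) : SG3) = a13 ∧
      (e (Monoid.Coprod.inl (Multiplicative.ofAdd ((0 : ℤ), (1 : ℤ)))) : SG3) = b13 ∧
      (e (Monoid.Coprod.inr (Multiplicative.ofAdd ((1 : ℤ), (0 : ℤ)))) : SG3) = a23 ∧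
      (e (Monoid.Coprod.inr (Multiplicative.ofAdd ((0 : ℤ), (1 : ℤ)))) : SG3) = b23 :=
  ⟨(MonoidHom.ofInjective SG3Proof.ψ_inj).trans (MulEquiv.subgroupCongr SG3Proof.ψ_range),
    SG3Proof.ψ1, SG3Proof.ψ2, SG3Proof.ψ3, SG3Proof.ψ4⟩
end

section
/- Let K be the group with presentation on six generators D, A13, A23, B12, B13, B23 subject to the relations: D commutes with each of B12, A13, A23, B13, B23; A13·B13 = B13·A13; A23·B23 = B23·A23; and B12·(A13·A23)·B12⁻¹ = A13·A23. Then there is a group isomorphism from K onto SP_3 = ker π ≤ SG_3 sending D ↦ σ1²·(σ2σ1²σ2⁻¹)·σ2², A13 ↦ σ2σ1²σ2⁻¹, A23 ↦ σ2², B12 ↦ σ1τ1, B13 ↦ σ2σ1τ1σ2⁻¹, B23 ↦ σ2τ2. -/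
/-- Defining relations of `SP₃` in the generators
`0 ↦ D`, `1 ↦ A₁₃`, `2 ↦ A₂₃`, `3 ↦ B₁₂`, `4 ↦ B₁₃`, `5 ↦ B₂₃`:
`D` is central among the generators, `[A₁₃,B₁₃] = [A₂₃,B₂₃] = 1` and
`B₁₂(A₁₃A₂₃)B₁₂⁻¹ = A₁₃A₂₃`. -/
def sp3CenterRels : Set (FreeGroup (Fin 6)) :=
  {FreeGroup.of 0 * FreeGroup.of 3 * (FreeGroup.of 3 * FreeGroup.of 0)⁻¹,
   FreeGroup.of 0 * FreeGroup.of 1 * (FreeGroup.of 1 * FreeGroup.of 0)⁻¹,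
   FreeGroup.of 0 * FreeGroup.of 2 * (FreeGroup.of 2 * FreeGroup.of 0)⁻¹,
   FreeGroup.of 0 * FreeGroup.of 4 * (FreeGroup.of 4 * FreeGroup.of 0)⁻¹,
   FreeGroup.of 0 * FreeGroup.of 5 * (FreeGroup.of 5 * FreeGroup.of 0)⁻¹,
   FreeGroup.of 1 * FreeGroup.of 4 * (FreeGroup.of 4 * FreeGroup.of 1)⁻¹,
   FreeGroup.of 2 * FreeGroup.of 5 * (FreeGroup.of 5 * FreeGroup.of 2)⁻¹,
   FreeGroup.of 3 * (FreeGroup.of 1 * FreeGroup.of 2) * (FreeGroup.of 3)⁻¹ *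
     (FreeGroup.of 1 * FreeGroup.of 2)⁻¹}


set_option linter.unusedSimpArgs false

namespace Stmt14

/-- If `g` commutes with `h`, the same holds inside a longer word. -/
lemma assoc_swap {G : Type*} [Group G] {g h : G} (e : g * h = h * g) (w : G) :
    g * (h * w) = h * (g * w) := by
  rw [← mul_assoc, e, mul_assoc]

section SGside
variable {G : Type*} [Group G] {s t u v : G}

lemma delta_eq (h3 : s * t * s = t * s * t) :
    s ^ 2 * (t * s ^ 2 * t⁻¹) * t ^ 2 = (s * t * s) * (s * t * s) := by
  have : s ^ 2 * (t * s ^ 2 * t⁻¹) * t ^ 2 = s * (s * t * s) * (s * t) := by simp [pow_two, mul_assoc]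
  rw [this]; nth_rw 1 [h3]; simp only [mul_assoc]
  have h := h3; simp only [mul_assoc] at h
  rw [h]

lemma delta_s (h3 : s * t * s = t * s * t) : (s * t * s) * s = t * (s * t * s) := by
  nth_rw 1 [h3]; simp only [mul_assoc]

lemma delta_t (h3 : s * t * s = t * s * t) : (s * t * s) * t = s * (s * t * s) := by
  nth_rw 2 [h3]; simp only [mul_assoc]

lemma delta_u (h1 : s * u = u * s) (h4 : s * t * u = v * s * t) :
    (s * t * s) * u = v * (s * t * s) := by
  rw [mul_assoc, h1, ← mul_assoc, h4]; simp only [mul_assoc]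

lemma delta_v (h1 : s * u = u * s) (h5 : t * s * v = u * t * s) :
    (s * t * s) * v = u * (s * t * s) := by
  calc (s * t * s) * v = s * (t * s * v) := by simp only [mul_assoc]
    _ = (s * u) * t * s := by rw [h5]; simp only [mul_assoc]
    _ = _ := by rw [h1]; simp only [mul_assoc]

lemma sq_swap {d g h : G} (e1 : d * g = h * d) (e2 : d * h = g * d) :
    Commute (d * d) g := by
  show d * d * g = g * (d * d)
  rw [mul_assoc, e1, ← mul_assoc, e2, mul_assoc]

/-- `σ₂⁻¹σ₁²σ₂ = σ₁σ₂²σ₁⁻¹`. -/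
lemma coset_sq (h3 : s * t * s = t * s * t) :
    s * t * t = ((t ^ 2)⁻¹ * (t * s ^ 2 * t⁻¹) * t ^ 2) * s := by
  have : ((t ^ 2)⁻¹ * (t * s ^ 2 * t⁻¹) * t ^ 2) * s = t⁻¹ * s * (s * t * s) := by simp [pow_two, mul_assoc]
  rw [this, h3]
  have : t⁻¹ * s * (t * s * t) = t⁻¹ * (s * t * s) * t := by group
  rw [this, h3]; group

lemma conj_v (h5 : t * s * v = u * t * s) : s * v = t⁻¹ * u * t * s := by
  have : s * v = t⁻¹ * (t * s * v) := by group
  rw [this, h5]; group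

end SGside

/-- The group given by the presentation. -/
abbrev K : Type := PresentedGroup sp3CenterRels

/-- Generators of `K`. -/
def kg (i : Fin 6) : K := PresentedGroup.of i

lemma krel {r : FreeGroup (Fin 6)} (h : r ∈ sp3CenterRels) : PresentedGroup.mk sp3CenterRels r = 1 :=
  PresentedGroup.one_of_mem h

lemma k03 : kg 0 * kg 3 = kg 3 * kg 0 :=
  mul_inv_eq_one.1 (krel (r := FreeGroup.of 0 * FreeGroup.of 3 * (FreeGroup.of 3 * FreeGroup.of 0)⁻¹)
    (by simp [sp3CenterRels]))

lemma k01 : kg 0 * kg 1 = kg 1 * kg 0 :=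
  mul_inv_eq_one.1 (krel (r := FreeGroup.of 0 * FreeGroup.of 1 * (FreeGroup.of 1 * FreeGroup.of 0)⁻¹)
    (by simp [sp3CenterRels]))

lemma k02 : kg 0 * kg 2 = kg 2 * kg 0 :=
  mul_inv_eq_one.1 (krel (r := FreeGroup.of 0 * FreeGroup.of 2 * (FreeGroup.of 2 * FreeGroup.of 0)⁻¹)
    (by simp [sp3CenterRels]))

lemma k04 : kg 0 * kg 4 = kg 4 * kg 0 :=
  mul_inv_eq_one.1 (krel (r := FreeGroup.of 0 * FreeGroup.of 4 * (FreeGroup.of 4 * FreeGroup.of 0)⁻¹)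
    (by simp [sp3CenterRels]))

lemma k05 : kg 0 * kg 5 = kg 5 * kg 0 :=
  mul_inv_eq_one.1 (krel (r := FreeGroup.of 0 * FreeGroup.of 5 * (FreeGroup.of 5 * FreeGroup.of 0)⁻¹)
    (by simp [sp3CenterRels]))

lemma k14 : kg 1 * kg 4 = kg 4 * kg 1 :=
  mul_inv_eq_one.1 (krel (r := FreeGroup.of 1 * FreeGroup.of 4 * (FreeGroup.of 4 * FreeGroup.of 1)⁻¹)
    (by simp [sp3CenterRels]))

lemma k25 : kg 2 * kg 5 = kg 5 * kg 2 :=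
  mul_inv_eq_one.1 (krel (r := FreeGroup.of 2 * FreeGroup.of 5 * (FreeGroup.of 5 * FreeGroup.of 2)⁻¹)
    (by simp [sp3CenterRels]))

lemma k312 : kg 3 * (kg 1 * kg 2) = (kg 1 * kg 2) * kg 3 :=
  mul_inv_eq_iff_eq_mul.1 (mul_inv_eq_one.1 (krel
    (r := FreeGroup.of 3 * (FreeGroup.of 1 * FreeGroup.of 2) * (FreeGroup.of 3)⁻¹ *
     (FreeGroup.of 1 * FreeGroup.of 2)⁻¹) (by simp [sp3CenterRels])))

/-- The element `A₁₂ = D (A₁₃A₂₃)⁻¹`. -/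
def ke : K := kg 0 * (kg 1 * kg 2)⁻¹

/-- Permutations of the six cosets `1, σ₁, σ₂, σ₁σ₂, σ₂σ₁, σ₁σ₂σ₁`. -/
def q1 : Fin 6 → Fin 6 := ![1, 0, 4, 5, 2, 3]
def q2 : Fin 6 → Fin 6 := ![2, 3, 0, 1, 5, 4]
lemma q1_inv (i : Fin 6) : q1 (q1 i) = i := by revert i; decide
lemma q2_inv (i : Fin 6) : q2 (q2 i) = i := by revert i; decide

/-- The monomial permutation of `K × Fin 6` attached to an involution and a cochain. -/
def mon (q : Fin 6 → Fin 6) (hq : ∀ i, q (q i) = i) (c : Fin 6 → K) : Equiv.Perm (K × Fin 6) where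
  toFun p := (p.1 * c p.2, q p.2)
  invFun p := (p.1 * (c (q p.2))⁻¹, q p.2)
  left_inv p := by simp [hq]
  right_inv p := by simp [hq]

def cs1 : Fin 6 → K := ![1, ke, 1, 1, kg 1, kg 2]
def cs2 : Fin 6 → K := ![1, 1, kg 2, (kg 2)⁻¹ * kg 1 * kg 2, 1, ke]
def ct1 : Fin 6 → K := ![kg 3 * ke⁻¹, kg 3, kg 4 * (kg 1)⁻¹, kg 5 * (kg 2)⁻¹, kg 4, kg 5]
def ct2 : Fin 6 → K := ![kg 5 * (kg 2)⁻¹, (kg 2)⁻¹ * (kg 4 * (kg 1)⁻¹) * kg 2, kg 5,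
  (kg 2)⁻¹ * kg 4 * kg 2, kg 3 * ke⁻¹, kg 3]

/-- The cochain and coset permutation of each generator. -/
def cc : Fin 4 → Fin 6 → K := ![cs1, cs2, ct1, ct2]
def qq : Fin 4 → Fin 6 → Fin 6 := ![q1, q2, q1, q2]
lemma qq_inv (g : Fin 4) (i : Fin 6) : qq g (qq g i) = i := by revert g i; decide

def act0 (g : Fin 4) : (Equiv.Perm (K × Fin 6))ᵐᵒᵖ := MulOpposite.op (mon (qq g) (qq_inv g) (cc g))

lemma act0_apply (g : Fin 4) (p : K × Fin 6) :
    (act0 g).unop p = (p.1 * cc g p.2, qq g p.2) := rfl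

lemma ke3 : Commute ke (kg 3) :=
  (show Commute (kg 0) (kg 3) from k03).mul_left
    (show Commute (kg 1 * kg 2) (kg 3) from k312.symm).inv_left

lemma c0 (i : Fin 6) : Commute (kg 0) (kg i) := by
  fin_cases i
  · exact Commute.refl _
  · exact k01
  · exact k02
  · exact k03
  · exact k04
  · exact k05

lemma w1 : kg 4 * (kg 1)⁻¹ * kg 1 = kg 4 := by group

/-- Word identities in `K` used for the relations. -/
lemma ke1 : ke * kg 1 = kg 0 * (kg 2)⁻¹ := by rw [ke]; group
lemma ke2 : kg 2 * ke = kg 0 * (kg 1)⁻¹ := by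
  rw [ke, ← mul_assoc, ← (c0 2).eq]; group
lemma ke12 : kg 1 * (kg 2 * ke) = kg 0 := by
  rw [ke2, ← mul_assoc, ← (c0 1).eq]; group

/-- Collection rules: `D` moves left, `A₁₃` before `B₁₃`, `A₂₃` before `B₂₃`. -/
lemma cd (i : Fin 6) (w : K) : kg i * (kg 0 * w) = kg 0 * (kg i * w) :=
  assoc_swap (c0 i).symm.eq w
lemma cd' (i : Fin 6) : kg i * (kg 0)⁻¹ = (kg 0)⁻¹ * kg i := (c0 i).symm.inv_right.eq
lemma ci (i : Fin 6) (w : K) : (kg i)⁻¹ * (kg 0 * w) = kg 0 * ((kg i)⁻¹ * w) :=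
  assoc_swap (c0 i).symm.inv_left.eq w
lemma ci' (i : Fin 6) (w : K) : (kg i) * ((kg 0)⁻¹ * w) = (kg 0)⁻¹ * (kg i * w) :=
  assoc_swap (c0 i).symm.inv_right.eq w
lemma y_a : kg 4 * (kg 1)⁻¹ = (kg 1)⁻¹ * kg 4 :=
  (show Commute (kg 4) (kg 1) from k14.symm).inv_right.eq
lemma y_a' (w : K) : kg 4 * ((kg 1)⁻¹ * w) = (kg 1)⁻¹ * (kg 4 * w) := assoc_swap y_a w
lemma ya (w : K) : kg 4 * (kg 1 * w) = kg 1 * (kg 4 * w) := assoc_swap k14.symm w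
lemma cj (i : Fin 6) : (kg i)⁻¹ * kg 0 = kg 0 * (kg i)⁻¹ := (c0 i).symm.inv_left.eq
lemma z_c : kg 5 * (kg 2)⁻¹ = (kg 2)⁻¹ * kg 5 :=
  (show Commute (kg 5) (kg 2) from k25.symm).inv_right.eq
lemma z_c' (w : K) : kg 5 * ((kg 2)⁻¹ * w) = (kg 2)⁻¹ * (kg 5 * w) := assoc_swap z_c w
lemma x_ac (w : K) : kg 3 * (kg 1 * (kg 2 * w)) = kg 1 * (kg 2 * (kg 3 * w)) := by
  have := assoc_swap k312 w
  simpa only [mul_assoc] using this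
lemma x_ac' : kg 3 * (kg 1 * kg 2) = kg 1 * (kg 2 * kg 3) := by
  have := k312
  simpa only [mul_assoc] using this
lemma ke_conj : ke * (kg 3 * ke⁻¹) = kg 3 := by
  rw [← mul_assoc, ke3.eq]; group

lemma act_rel2 (g₁ g₂ h₁ h₂ : Fin 4)
    (hq : ∀ i, qq g₂ (qq g₁ i) = qq h₂ (qq h₁ i))
    (hc : ∀ i, cc g₁ i * cc g₂ (qq g₁ i) = cc h₁ i * cc h₂ (qq h₁ i)) :
    act0 g₁ * act0 g₂ = act0 h₁ * act0 h₂ := by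
  apply MulOpposite.unop_injective
  ext1 p
  simp only [MulOpposite.unop_mul, Equiv.Perm.mul_apply, act0_apply, hq, mul_assoc, hc]

lemma act_rel3 (g₁ g₂ g₃ h₁ h₂ h₃ : Fin 4)
    (hq : ∀ i, qq g₃ (qq g₂ (qq g₁ i)) = qq h₃ (qq h₂ (qq h₁ i)))
    (hc : ∀ i, cc g₁ i * (cc g₂ (qq g₁ i) * cc g₃ (qq g₂ (qq g₁ i))) =
      cc h₁ i * (cc h₂ (qq h₁ i) * cc h₃ (qq h₂ (qq h₁ i)))) :
    act0 g₁ * act0 g₂ * act0 g₃ = act0 h₁ * act0 h₂ * act0 h₃ := by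
  apply MulOpposite.unop_injective
  ext1 p
  simp only [MulOpposite.unop_mul, Equiv.Perm.mul_apply, act0_apply, hq, mul_assoc, hc]

lemma r1 : act0 0 * act0 2 = act0 2 * act0 0 := by
  refine act_rel2 _ _ _ _ (by decide) fun i => ?_
  fin_cases i <;> simp [cc, qq, q1, q2, cs1, cs2, ct1, ct2]
  all_goals first | exact ke_conj | simp [ke, mul_assoc, cd 1, cd 2, cd 4, cd 5, cd' 1, cd' 2, cd' 3,
    ci 1, ci 2, ci' 1, ci' 2, ci' 3, y_a, y_a', ya, cj, z_c, z_c', x_ac, x_ac']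

lemma r2 : act0 1 * act0 3 = act0 3 * act0 1 := by
  refine act_rel2 _ _ _ _ (by decide) fun i => ?_
  fin_cases i <;> simp [cc, qq, q1, q2, cs1, cs2, ct1, ct2]
  all_goals first | exact ke_conj | simp [ke, mul_assoc, cd 1, cd 2, cd 4, cd 5, cd' 1, cd' 2, cd' 3,
    ci 1, ci 2, ci' 1, ci' 2, ci' 3, y_a, y_a', ya, cj, z_c, z_c', x_ac, x_ac']

lemma r3 : act0 0 * act0 1 * act0 0 = act0 1 * act0 0 * act0 1 := by
  refine act_rel3 _ _ _ _ _ _ (by decide) fun i => ?_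
  fin_cases i <;> simp [cc, qq, q1, q2, cs1, cs2, ct1, ct2]
  all_goals first | exact ke_conj | simp [ke, mul_assoc, cd 1, cd 2, cd 4, cd 5, cd' 1, cd' 2, cd' 3,
    ci 1, ci 2, ci' 1, ci' 2, ci' 3, y_a, y_a', ya, cj, z_c, z_c', x_ac, x_ac']

lemma r4 : act0 0 * act0 1 * act0 2 = act0 3 * act0 0 * act0 1 := by
  refine act_rel3 _ _ _ _ _ _ (by decide) fun i => ?_
  fin_cases i <;> simp [cc, qq, q1, q2, cs1, cs2, ct1, ct2]
  all_goals first | exact ke_conj | simp [ke, mul_assoc, cd 1, cd 2, cd 4, cd 5, cd' 1, cd' 2, cd' 3,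
    ci 1, ci 2, ci' 1, ci' 2, ci' 3, y_a, y_a', ya, cj, z_c, z_c', x_ac, x_ac']

lemma r5 : act0 1 * act0 0 * act0 3 = act0 2 * act0 1 * act0 0 := by
  refine act_rel3 _ _ _ _ _ _ (by decide) fun i => ?_
  fin_cases i <;> simp [cc, qq, q1, q2, cs1, cs2, ct1, ct2]
  all_goals first | exact ke_conj | simp [ke, mul_assoc, cd 1, cd 2, cd 4, cd 5, cd' 1, cd' 2, cd' 3,
    ci 1, ci 2, ci' 1, ci' 2, ci' 3, y_a, y_a', ya, cj, z_c, z_c', x_ac, x_ac']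


/-- Right action of `SG₃` on `K × Fin 6`. -/
def act : SG3 →* (Equiv.Perm (K × Fin 6))ᵐᵒᵖ := PresentedGroup.toGroup (f := act0) (by
  intro r hr
  simp only [sg3Rels, Set.mem_insert_iff, Set.mem_singleton_iff] at hr
  rcases hr with rfl | rfl | rfl | rfl | rfl <;>
    simp only [map_mul, map_inv, FreeGroup.lift_apply_of, mul_inv_eq_one]
  · exact r1
  · exact r2
  · exact r3
  · exact r4
  · exact r5)

lemma act_of (g : Fin 4) : act (PresentedGroup.of g) = act0 g := PresentedGroup.toGroup.of _

lemma sg_rel {r : FreeGroup (Fin 4)} (h : r ∈ sg3Rels) : PresentedGroup.mk sg3Rels r = 1 :=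
  PresentedGroup.one_of_mem h

lemma s1t1 : σ1 * τ1 = τ1 * σ1 :=
  mul_inv_eq_one.1 (sg_rel (r := FreeGroup.of 0 * FreeGroup.of 2 *
    (FreeGroup.of 2 * FreeGroup.of 0)⁻¹) (by simp [sg3Rels]))
lemma s2t2 : σ2 * τ2 = τ2 * σ2 :=
  mul_inv_eq_one.1 (sg_rel (r := FreeGroup.of 1 * FreeGroup.of 3 *
    (FreeGroup.of 3 * FreeGroup.of 1)⁻¹) (by simp [sg3Rels]))
lemma braid : σ1 * σ2 * σ1 = σ2 * σ1 * σ2 :=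
  mul_inv_eq_one.1 (sg_rel (r := FreeGroup.of 0 * FreeGroup.of 1 * FreeGroup.of 0 *
     (FreeGroup.of 1 * FreeGroup.of 0 * FreeGroup.of 1)⁻¹) (by simp [sg3Rels]))
lemma braid' : σ2 * (σ1 * σ2) = σ1 * (σ2 * σ1) := by
  simpa only [mul_assoc] using braid.symm
lemma sst1 : σ1 * σ2 * τ1 = τ2 * σ1 * σ2 :=
  mul_inv_eq_one.1 (sg_rel (r := FreeGroup.of 0 * FreeGroup.of 1 * FreeGroup.of 2 *
     (FreeGroup.of 3 * FreeGroup.of 0 * FreeGroup.of 1)⁻¹) (by simp [sg3Rels]))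
lemma sst2 : σ2 * σ1 * τ2 = τ1 * σ2 * σ1 :=
  mul_inv_eq_one.1 (sg_rel (r := FreeGroup.of 1 * FreeGroup.of 0 * FreeGroup.of 3 *
     (FreeGroup.of 2 * FreeGroup.of 1 * FreeGroup.of 0)⁻¹) (by simp [sg3Rels]))

/-- The central element. -/
lemma d_eq : a12 * a13 * a23 = (σ1 * σ2 * σ1) * (σ1 * σ2 * σ1) := delta_eq braid
lemma d_s1 : Commute (a12 * a13 * a23) σ1 := d_eq ▸ sq_swap (delta_s braid) (delta_t braid)
lemma d_s2 : Commute (a12 * a13 * a23) σ2 := d_eq ▸ sq_swap (delta_t braid) (delta_s braid)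
lemma d_t1 : Commute (a12 * a13 * a23) τ1 :=
  d_eq ▸ sq_swap (delta_u s1t1 sst1) (delta_v s1t1 sst2)
lemma d_t2 : Commute (a12 * a13 * a23) τ2 :=
  d_eq ▸ sq_swap (delta_v s1t1 sst2) (delta_u s1t1 sst1)

lemma ab13 : Commute a13 b13 := by
  have h : Commute (σ1 ^ 2) (σ1 * τ1) :=
    ((Commute.refl σ1).mul_right (show Commute σ1 τ1 from s1t1)).pow_left 2
  have := h.conj σ2
  rwa [← mul_assoc σ2 σ1 τ1] at this
lemma ab23 : Commute a23 b23 :=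
  ((Commute.refl σ2).mul_right (show Commute σ2 τ2 from s2t2)).pow_left 2

lemma d_b12 : Commute (a12 * a13 * a23) b12 := d_s1.mul_right d_t1
lemma d_a13 : Commute (a12 * a13 * a23) a13 :=
  (d_s2.mul_right (d_s1.pow_right 2)).mul_right d_s2.inv_right
lemma d_a23 : Commute (a12 * a13 * a23) a23 := d_s2.pow_right 2
lemma d_b13 : Commute (a12 * a13 * a23) b13 :=
  ((d_s2.mul_right d_s1).mul_right d_t1).mul_right d_s2.inv_right
lemma d_b23 : Commute (a12 * a13 * a23) b23 := d_s2.mul_right d_t2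

lemma b_aa : Commute b12 (a13 * a23) := by
  have h : Commute b12 a12 :=
    (((Commute.refl σ1).mul_left (show Commute τ1 σ1 from s1t1.symm))).pow_right 2
  have e : a13 * a23 = a12⁻¹ * (a12 * a13 * a23) := by group
  rw [e]; exact h.inv_right.mul_right d_b12.symm

/-- Images of generators of `K`. -/
def f0 : Fin 6 → SG3 := ![a12 * a13 * a23, a13, a23, b12, b13, b23]

def f : K →* SG3 := PresentedGroup.toGroup (f := f0) (by
  intro r hr
  simp only [sp3CenterRels, Set.mem_insert_iff, Set.mem_singleton_iff] at hr
  rcases hr with rfl | rfl | rfl | rfl | rfl | rfl | rfl | rfl <;>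
    simp only [map_mul, map_inv, FreeGroup.lift_apply_of, mul_inv_eq_one]
  · exact d_b12
  · exact d_a13
  · exact d_a23
  · exact d_b13
  · exact d_b23
  · exact ab13
  · exact ab23
  · exact mul_inv_eq_iff_eq_mul.2 b_aa)

lemma f_kg (i : Fin 6) : f (kg i) = f0 i := PresentedGroup.toGroup.of _
lemma fk0 : f (kg 0) = a12 * a13 * a23 := f_kg 0
lemma fk1 : f (kg 1) = a13 := f_kg 1
lemma fk2 : f (kg 2) = a23 := f_kg 2
lemma fk3 : f (kg 3) = b12 := f_kg 3
lemma fk4 : f (kg 4) = b13 := f_kg 4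
lemma fk5 : f (kg 5) = b23 := f_kg 5
lemma f_ke : f ke = a12 := by
  rw [ke, map_mul, map_inv, map_mul, fk0, fk1, fk2]; group

/-- Coset representatives. -/
def rep : Fin 6 → SG3 := ![1, σ1, σ2, σ1 * σ2, σ2 * σ1, σ1 * σ2 * σ1]

def gen : Fin 4 → SG3 := ![σ1, σ2, τ1, τ2]
lemma gen_eq (g : Fin 4) : gen g = PresentedGroup.of g := by fin_cases g <;> rfl

lemma rep_gen (i : Fin 6) (g : Fin 4) : rep i * gen g = f (cc g i) * rep (qq g i) := by
  fin_cases g <;> fin_cases i <;>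
    simp [cc, qq, q1, q2, cs1, cs2, ct1, ct2, rep, gen, fk1, fk2, fk3, fk4, fk5, f_ke, a12, a13, a23, b12, b13, b23, pow_two]
  · simp [mul_assoc]
  · rw [delta_s braid, braid]; simp only [mul_assoc]
  · simpa only [pow_two, mul_inv_rev] using coset_sq braid
  · exact braid.symm
  · rw [delta_t braid]; simp only [mul_assoc]
  · rw [s1t1]; simp [mul_assoc]
  · rw [mul_assoc σ2 σ1 τ1, s1t1]; simp [mul_assoc]
  · rw [braid, s2t2, sst1]; simp [mul_assoc]
  · rw [delta_u s1t1 sst1, braid, s2t2]; simp only [mul_assoc]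
  · rw [s2t2]; simp [mul_assoc]
  · rw [conj_v sst2, mul_assoc σ2 σ1 τ1, s1t1]; simp [mul_assoc, braid']
  · rw [mul_assoc σ1, s2t2, ← mul_assoc, conj_v sst2, mul_assoc σ2 σ1 τ1, s1t1]
    simp [mul_assoc, braid']
  · rw [s1t1, sst2]; simp [mul_assoc]
  · rw [delta_v s1t1 sst2, s1t1]; simp only [mul_assoc]

lemma cover (x : SG3) : ∃ k i, x = f k * rep i := by
  have key : ∀ x : SG3, ∀ k i, ∃ k' i', f k * rep i * x = f k' * rep i' := by
    intro x
    induction x using PresentedGroup.induction_on with | _ z =>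
    induction z using FreeGroup.induction_on with
    | C1 => intro k i; exact ⟨k, i, by simp⟩
    | of g =>
      intro k i
      refine ⟨k * cc g i, qq g i, ?_⟩
      have := rep_gen i g
      rw [gen_eq] at this
      rw [map_mul, mul_assoc, mul_assoc, ← this]; rfl
    | inv_of g _ =>
      intro k i
      refine ⟨k * (cc g (qq g i))⁻¹, qq g i, ?_⟩
      have := rep_gen (qq g i) g
      rw [gen_eq, qq_inv] at this
      have h2 : PresentedGroup.mk sg3Rels (FreeGroup.of g) = PresentedGroup.of g := rfl
      rw [map_inv, h2, mul_inv_eq_iff_eq_mul, mul_assoc, this, map_mul, map_inv]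
      group
    | mul a b ha hb =>
      intro k i
      obtain ⟨k1, i1, h1⟩ := ha k i
      obtain ⟨k2, i2, h2⟩ := hb k1 i1
      exact ⟨k2, i2, by rw [map_mul, ← mul_assoc, h1, h2]⟩
  obtain ⟨k, i, h⟩ := key x 1 0
  exact ⟨k, i, by simpa [rep] using h⟩

lemma act_s1 (p : K × Fin 6) : (act σ1).unop p = (p.1 * cs1 p.2, q1 p.2) :=
  congrArg (fun z : (Equiv.Perm (K × Fin 6))ᵐᵒᵖ => MulOpposite.unop z p) (act_of 0)
lemma act_s2 (p : K × Fin 6) : (act σ2).unop p = (p.1 * cs2 p.2, q2 p.2) :=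
  congrArg (fun z : (Equiv.Perm (K × Fin 6))ᵐᵒᵖ => MulOpposite.unop z p) (act_of 1)
lemma act_t1 (p : K × Fin 6) : (act τ1).unop p = (p.1 * ct1 p.2, q1 p.2) :=
  congrArg (fun z : (Equiv.Perm (K × Fin 6))ᵐᵒᵖ => MulOpposite.unop z p) (act_of 2)
lemma act_t2 (p : K × Fin 6) : (act τ2).unop p = (p.1 * ct2 p.2, q2 p.2) :=
  congrArg (fun z : (Equiv.Perm (K × Fin 6))ᵐᵒᵖ => MulOpposite.unop z p) (act_of 3)

lemma act_b12 (k : K) : (act b12).unop (k, 0) = (k * kg 3, 0) := by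
  simp [b12, act_s1, act_t1, cs1, ct1, q1]
lemma act_b23 (k : K) : (act b23).unop (k, 0) = (k * kg 5, 0) := by
  simp [b23, act_s2, act_t2, cs2, ct2, q2]
lemma act_a12 (k : K) : (act a12).unop (k, 0) = (k * ke, 0) := by
  simp [a12, pow_two, act_s1, cs1, q1]
lemma act_a23 (k : K) : (act a23).unop (k, 0) = (k * kg 2, 0) := by
  simp [a23, pow_two, act_s2, cs2, q2]
lemma act_a13 (k : K) : (act a13).unop (k, 0) = (k * kg 1, 0) := by
  rw [a13, map_mul, MulOpposite.unop_mul, Equiv.Perm.mul_apply, map_inv, MulOpposite.unop_inv,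
    Equiv.Perm.inv_eq_iff_eq]
  simp [pow_two, act_s1, act_s2, cs1, cs2, q1, q2]
lemma act_b13 (k : K) : (act b13).unop (k, 0) = (k * kg 4, 0) := by
  rw [b13, map_mul, MulOpposite.unop_mul, Equiv.Perm.mul_apply, map_inv, MulOpposite.unop_inv,
    Equiv.Perm.inv_eq_iff_eq]
  simp [act_s1, act_s2, act_t1, cs1, cs2, ct1, q1, q2]
lemma act_d (k : K) : (act (a12 * a13 * a23)).unop (k, 0) = (k * kg 0, 0) := by
  simp only [map_mul, MulOpposite.unop_mul, Equiv.Perm.mul_apply, act_a12, act_a13, act_a23]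
  rw [ke]; simp only [Prod.mk.injEq, and_true]
  group

lemma act_f0 (i : Fin 6) (k : K) : (act (f0 i)).unop (k, 0) = (k * kg i, 0) := by
  fin_cases i
  · exact act_d k
  · exact act_a13 k
  · exact act_a23 k
  · exact act_b12 k
  · exact act_b13 k
  · exact act_b23 k

lemma act_f (x : K) : ∀ k, (act (f x)).unop (k, 0) = (k * x, 0) := by
  induction x using PresentedGroup.induction_on with | _ z =>
  induction z using FreeGroup.induction_on with
  | C1 => intro k; simp
  | of i => intro k; exact (congrArg (fun z => (act z).unop (k, 0)) (f_kg i)).trans (act_f0 i k)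
  | inv_of i h =>
    intro k
    rw [map_inv, map_inv, map_inv, MulOpposite.unop_inv, Equiv.Perm.inv_eq_iff_eq, h]
    simp
  | mul a b ha hb =>
    intro k
    simp only [map_mul, MulOpposite.unop_mul, Equiv.Perm.mul_apply, ha, hb, mul_assoc]

lemma f_inj : Function.Injective f := by
  intro x y h
  have hx := act_f x 1
  rw [h, act_f y 1] at hx
  simpa using hx.symm

end Stmt14

/-- The group presented by `sp3CenterRels` is isomorphic to `SP₃ = ker π`, via
`D ↦ δ = a₁₂a₁₃a₂₃`, `A₁₃ ↦ a₁₃`, `A₂₃ ↦ a₂₃`, `B₁₂ ↦ b₁₂`, `B₁₃ ↦ b₁₃`, `B₂₃ ↦ b₂₃`. -/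
theorem stmt14 (π : SG3 →* Equiv.Perm (Fin 3))
    (hσ1 : π σ1 = Equiv.swap 0 1) (hτ1 : π τ1 = Equiv.swap 0 1)
    (hσ2 : π σ2 = Equiv.swap 1 2) (hτ2 : π τ2 = Equiv.swap 1 2) :
    ∃ e : PresentedGroup sp3CenterRels ≃* MonoidHom.ker π,
      (e (PresentedGroup.of 0) : SG3) = a12 * a13 * a23 ∧
      (e (PresentedGroup.of 1) : SG3) = a13 ∧
      (e (PresentedGroup.of 2) : SG3) = a23 ∧
      (e (PresentedGroup.of 3) : SG3) = b12 ∧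
      (e (PresentedGroup.of 4) : SG3) = b13 ∧
      (e (PresentedGroup.of 5) : SG3) = b23 := by
  have hker : ∀ x, Stmt14.f x ∈ MonoidHom.ker π := by
    intro x
    induction x using PresentedGroup.induction_on with | _ z =>
    induction z using FreeGroup.induction_on with
    | C1 => simp
    | of i =>
      change Stmt14.f (Stmt14.kg i) ∈ _
      rw [Stmt14.f_kg, MonoidHom.mem_ker]
      fin_cases i <;>
        simp [Stmt14.f0, a12, a13, a23, b12, b13, b23, hσ1, hσ2, hτ1, hτ2, pow_two, mul_assoc]
    | inv_of i h => rw [map_inv, map_inv]; exact inv_mem h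
    | mul a b ha hb => rw [map_mul, map_mul]; exact mul_mem ha hb
  have hbij : Function.Bijective (Stmt14.f.codRestrict (MonoidHom.ker π) hker) := by
    constructor
    · intro x y h
      exact Stmt14.f_inj (congrArg Subtype.val h)
    · rintro ⟨y, hy⟩
      obtain ⟨k, i, rfl⟩ := Stmt14.cover y
      have h : π (Stmt14.rep i) = 1 := by
        have h1 : π (Stmt14.f k) = 1 := hker k
        have h2 : π (Stmt14.f k * Stmt14.rep i) = 1 := hy
        rwa [map_mul, h1, one_mul] at h2
      have hi : i = 0 := by
        revert h
        fin_cases i <;> simp only [Stmt14.rep, Fin.mk_one, Fin.zero_eta, Fin.reduceFinMk, Matrix.cons_val, map_mul, map_one, hσ1, hσ2] <;> decide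
      subst hi
      exact ⟨k, Subtype.ext (by simp [Stmt14.rep])⟩
  exact ⟨MulEquiv.ofBijective _ hbij, Stmt14.fk0, Stmt14.fk1, Stmt14.fk2, Stmt14.fk3, Stmt14.fk4,
    Stmt14.fk5⟩
end
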